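/- arXiv:1103.0316 — 5 statements merged into one kernel-verified Lean document; each statement's English description precedes it below -/
import Mathlib

section
/- Key Lemma on rational approximations: Let X, X_m, P_m, J_m form an approximation scheme and let A, A_m be a stable and consistent approximating family of operators. Let r be a rational function with r(0) = 1, r'(0) = 1 that is bounded on the closed left half-plane ℂ₋ = {z ∈ ℂ : Re z ≤ 0}, with partial fraction decomposition r(z) = Σ_{i=1}^{l} Σ_{j=1}^{ν_i} C_{ij} (1 − z/λ_i)^{−j} where Re λ_i > 0 for all i, and define r(hA_m) := Σ_{i=1}^{l} Σ_{j=1}^{ν_i} C_{ij} [ (λ_i/h) R(λ_i/h, A_m) ]^{j} for h > 0. Then for every x ∈ D(A), ‖(J_m r(hA_m) P_m x − J_m P_m x)/h − J_m A_m P_m x‖ → 0 as h → 0+, uniformly in m ∈ ℕ. -/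
open Filter Topology

/-- `R` is the resolvent operator `R(lam, A) = (lam - A)⁻¹` of the (possibly
unbounded) linear operator `A`, given as a partially defined linear map. -/
structure IsResolvent {Y : Type*} [NormedAddCommGroup Y] [NormedSpace ℂ Y]
    (A : Y →ₗ.[ℂ] Y) (lam : ℂ) (R : Y →L[ℂ] Y) : Prop where
  mem : ∀ x : Y, R x ∈ A.domain
  eq_right : ∀ x : Y, lam • R x - A ⟨R x, mem x⟩ = x
  eq_left : ∀ y : A.domain, R (lam • (y : Y) - A y) = (y : Y)

/-- The operator `r(h A)` where the rational function `r` is given through its partial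
fraction decomposition `r(z) = Σ_{i,j} C i j • (1 - z/lam i)⁻ʲ` and the operator `A`
through its resolvent family `R`:  `r(h A) = Σ_{i,j} C i j • [(lam i/h) R(lam i/h, A)]ʲ`.
(For `h ≤ 0` it is defined to be the identity, corresponding to `r(0·A) = I`.) -/
noncomputable def ratOp {Y : Type*} [NormedAddCommGroup Y] [NormedSpace ℂ Y]
    (l : ℕ) (ν : Fin l → ℕ) (lam : Fin l → ℂ) (C : Fin l → ℕ → ℂ)
    (R : ℂ → Y →L[ℂ] Y) (h : ℝ) : Y →L[ℂ] Y :=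
  if h ≤ 0 then 1 else
    ∑ i, ∑ j ∈ Finset.Icc 1 (ν i), C i j • ((lam i / (h : ℂ)) • R (lam i / (h : ℂ))) ^ j

/-- The rational function `r(z) = Σ_{i,j} C i j (1 - z/lam i)⁻ʲ` given by a partial
fraction decomposition. -/
noncomputable def pfdFun (l : ℕ) (ν : Fin l → ℕ) (lam : Fin l → ℂ) (C : Fin l → ℕ → ℂ)
    (z : ℂ) : ℂ :=
  ∑ i, ∑ j ∈ Finset.Icc 1 (ν i), C i j * (1 - z / lam i) ^ (-(j : ℤ))

section Resolvent

variable {Y : Type*} [NormedAddCommGroup Y] [NormedSpace ℂ Y]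

theorem ContinuousLinearMap.pow_apply_sub_self (T : Y →L[ℂ] Y) (w : Y) (j : ℕ) :
    (T ^ j) w - w = ∑ k ∈ Finset.range j, (T ^ k) (T w - w) := by
  induction j with
  | zero => simp
  | succ j ih =>
    rw [Finset.sum_range_succ, ← ih, map_sub, pow_succ, mul_apply_eq_comp]
    abel

theorem ContinuousLinearMap.norm_pow_apply_le {T : Y →L[ℂ] Y} {B : ℝ} (hB : 0 ≤ B)
    (hT : ‖T‖ ≤ B) (w : Y) (k : ℕ) : ‖(T ^ k) w‖ ≤ B ^ k * ‖w‖ := by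
  induction k generalizing w with
  | zero => simp
  | succ k ih =>
    rw [pow_succ, mul_apply_eq_comp, pow_succ, mul_assoc]
    exact (ih _).trans (by gcongr; exact T.le_of_opNorm_le hT w)

theorem ContinuousLinearMap.norm_pow_apply_sub_self_le {T : Y →L[ℂ] Y} {B : ℝ} (hB : 0 ≤ B)
    (hT : ‖T‖ ≤ B) (w : Y) (j : ℕ) :
    ‖(T ^ j) w - w‖ ≤ (∑ k ∈ Finset.range j, B ^ k) * ‖T w - w‖ := by
  rw [T.pow_apply_sub_self, Finset.sum_mul]
  exact norm_sum_le_of_le _ fun k _ => norm_pow_apply_le hB hT _ k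

theorem IsResolvent.smul_apply_sub_self {A : Y →ₗ.[ℂ] Y} {μ : ℂ} {R : Y →L[ℂ] Y}
    (hR : IsResolvent A μ R) (hμ : μ ≠ 0) (v : A.domain) :
    (μ • R) (v : Y) - v = μ⁻¹ • (μ • R) (A v) := by
  have h := hR.eq_left v
  rw [map_sub, map_smul] at h
  rw [smul_apply, smul_apply, inv_smul_smul₀ hμ,
    sub_eq_iff_eq_add, add_comm, ← sub_eq_iff_eq_add, h]

theorem IsResolvent.smul_pow_apply_sub_self {A : Y →ₗ.[ℂ] Y} {μ : ℂ} {R : Y →L[ℂ] Y}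
    (hR : IsResolvent A μ R) (hμ : μ ≠ 0) (v : A.domain) (j : ℕ) :
    ((μ • R) ^ j) (v : Y) - v = μ⁻¹ • ∑ k ∈ Finset.range j, ((μ • R) ^ (k + 1)) (A v) := by
  rw [ContinuousLinearMap.pow_apply_sub_self, hR.smul_apply_sub_self hμ, Finset.smul_sum]
  refine Finset.sum_congr rfl fun k _ => ?_
  rw [map_smul, pow_succ, mul_apply_eq_comp]

theorem norm_div_smul_le {R : Y →L[ℂ] Y} {μ : ℂ} {h M : ℝ} (hμ : 0 < μ.re) (hh : 0 < h)
    (hR : (μ / (h : ℂ)).re * ‖R‖ ≤ M) : ‖(μ / (h : ℂ)) • R‖ ≤ ‖μ‖ / μ.re * M := by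
  rw [Complex.div_ofReal_re] at hR
  rw [norm_smul, norm_div, Complex.norm_real, Real.norm_of_nonneg hh.le]
  calc ‖μ‖ / h * ‖R‖ = ‖μ‖ / μ.re * (μ.re / h * ‖R‖) := by field_simp
    _ ≤ ‖μ‖ / μ.re * M := by gcongr

/-- The difference quotient of `h ↦ r(h A)` at `v`, minus `A v`, for a rational function with
`r(0) = r'(0) = 1`. -/
theorem ratOp_difference_quotient_sub {A : Y →ₗ.[ℂ] Y} {R : ℂ → Y →L[ℂ] Y} {l : ℕ}
    {ν : Fin l → ℕ} {lam : Fin l → ℂ} {C : Fin l → ℕ → ℂ} {h : ℝ} (hh : 0 < h)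
    (hlam : ∀ i, lam i ≠ 0) (hR : ∀ i, IsResolvent A (lam i / h) (R (lam i / h)))
    (h0 : ∑ i, ∑ j ∈ Finset.Icc 1 (ν i), C i j = 1)
    (h1 : ∑ i, ∑ j ∈ Finset.Icc 1 (ν i), C i j * (j / lam i) = 1) (v : A.domain) :
    (h : ℂ)⁻¹ • (ratOp l ν lam C R h (v : Y) - v) - A v =
      ∑ i, ∑ j ∈ Finset.Icc 1 (ν i), (C i j / lam i) • ∑ k ∈ Finset.range j,
        ((((lam i / (h : ℂ)) • R (lam i / h)) ^ (k + 1)) (A v) - A v) := by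
  have hc : (h : ℂ) ≠ 0 := by exact_mod_cast hh.ne'
  have e0 : ratOp l ν lam C R h (v : Y) - v = ∑ i, ∑ j ∈ Finset.Icc 1 (ν i),
      C i j • ((((lam i / (h : ℂ)) • R (lam i / h)) ^ j) (v : Y) - v) := by
    have ev : ∑ i, ∑ j ∈ Finset.Icc 1 (ν i), C i j • (v : Y) = v := by
      simp only [← Finset.sum_smul, h0, one_smul]
    rw [ratOp, if_neg hh.not_ge]
    simp only [sum_apply, smul_apply, smul_sub, Finset.sum_sub_distrib, ev]
  have e1 : A v = ∑ i, ∑ j ∈ Finset.Icc 1 (ν i), (C i j * (j / lam i)) • A v := by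
    simp only [← Finset.sum_smul, h1, one_smul]
  rw [e0]
  conv_lhs => rw [e1]
  simp only [Finset.smul_sum, ← Finset.sum_sub_distrib]
  refine Finset.sum_congr rfl fun i _ => Finset.sum_congr rfl fun j _ => ?_
  rw [(hR i).smul_pow_apply_sub_self (div_ne_zero (hlam i) hc), ← Finset.smul_sum,
    Finset.sum_sub_distrib, smul_sub, smul_smul, smul_smul, Finset.sum_const, Finset.card_range,
    ← Nat.cast_smul_eq_nsmul ℂ, smul_smul]
  congr 2 <;> field_simp

end Resolvent

theorem pfdFun_zero (l : ℕ) (ν : Fin l → ℕ) (lam : Fin l → ℂ) (C : Fin l → ℕ → ℂ) :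
    pfdFun l ν lam C 0 = ∑ i, ∑ j ∈ Finset.Icc 1 (ν i), C i j := by
  simp [pfdFun]

theorem hasDerivAt_pfdFun_zero (l : ℕ) (ν : Fin l → ℕ) (lam : Fin l → ℂ) (C : Fin l → ℕ → ℂ) :
    HasDerivAt (pfdFun l ν lam C)
      (∑ i, ∑ j ∈ Finset.Icc 1 (ν i), C i j * (j / lam i)) 0 := by
  unfold pfdFun
  refine HasDerivAt.fun_sum fun i _ => HasDerivAt.fun_sum fun j _ => HasDerivAt.const_mul _ ?_
  have h1 : HasDerivAt (fun z : ℂ => 1 - z / lam i) (-(1 / lam i)) 0 :=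
    ((hasDerivAt_id (0 : ℂ)).div_const (lam i)).const_sub 1
  have h2 : HasDerivAt (fun z : ℂ => z ^ (-(j : ℤ)))
      (((-(j : ℤ) : ℤ) : ℂ) * (1 - 0 / lam i) ^ (-(j : ℤ) - 1)) (1 - 0 / lam i) :=
    hasDerivAt_zpow _ _ (Or.inl (by simp))
  refine (h2.comp (0 : ℂ) h1).congr_deriv ?_
  simp [div_eq_mul_inv]

section Family

variable {Z : ℕ → Type*} [∀ m, NormedAddCommGroup (Z m)] [∀ m, NormedSpace ℂ (Z m)]

/-- If a family of vectors is uniformly approximated by vectors `v m` of the domains with bounded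
`A m (v m)`, then `(μ/h) R(μ/h, A m)` converges to the identity along it, uniformly in `m`. -/
theorem eventually_norm_smul_resolvent_sub_le {A : ∀ m, Z m →ₗ.[ℂ] Z m}
    {R : ∀ m, ℂ → Z m →L[ℂ] Z m} {M : ℝ} (hM : 0 ≤ M)
    (hR : ∀ m, ∀ μ : ℂ, 0 < μ.re → IsResolvent (A m) μ (R m μ) ∧ μ.re * ‖R m μ‖ ≤ M)
    {w : ∀ m, Z m}
    (hw : ∀ ε > (0 : ℝ), ∃ (v : ∀ m, (A m).domain) (L : ℝ),
      ∀ m, ‖w m - v m‖ ≤ ε ∧ ‖A m (v m)‖ ≤ L)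
    {μ : ℂ} (hμ : 0 < μ.re) {ε : ℝ} (hε : 0 < ε) :
    ∀ᶠ h : ℝ in 𝓝[>] 0, ∀ m, ‖((μ / (h : ℂ)) • R m (μ / h)) (w m) - w m‖ ≤ ε := by
  have hμ0 : μ ≠ 0 := by
    rintro rfl
    simp at hμ
  set B := ‖μ‖ / μ.re * M with hBdef
  have hB : 0 ≤ B := by positivity
  obtain ⟨v, L, hv⟩ := hw (ε / 2 / (B + 1)) (by positivity)
  have hlim : Tendsto (fun h : ℝ => h / ‖μ‖ * (B * L)) (𝓝[>] 0) (𝓝 0) := by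
    have : Tendsto (fun h : ℝ => h / ‖μ‖ * (B * L)) (𝓝 0) (𝓝 (0 / ‖μ‖ * (B * L))) :=
      Continuous.tendsto (by fun_prop) 0
    simpa using this.mono_left nhdsWithin_le_nhds
  filter_upwards [hlim.eventually (ge_mem_nhds (half_pos hε)), self_mem_nhdsWithin] with h hL hh m
  have hh : 0 < h := hh
  have hc : (h : ℂ) ≠ 0 := by exact_mod_cast hh.ne'
  obtain ⟨hres, hnorm⟩ := hR m (μ / h) (by rw [Complex.div_ofReal_re]; positivity)
  have hT := norm_div_smul_le hμ hh hnorm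
  have hdom := hres.smul_apply_sub_self (div_ne_zero hμ0 hc) (v m)
  set T := (μ / (h : ℂ)) • R m (μ / h)
  have split : T (w m) - w m = (T (w m - v m) - (w m - v m)) + (T (v m) - v m) := by
    rw [map_sub]
    abel
  have b1 : ‖T (w m - v m) - (w m - v m)‖ ≤ ε / 2 :=
    calc ‖T (w m - v m) - (w m - v m)‖ ≤ B * ‖w m - v m‖ + ‖w m - v m‖ :=
          (norm_sub_le _ _).trans (by gcongr; exact T.le_of_opNorm_le hT _)
      _ = (B + 1) * ‖w m - v m‖ := by ring
      _ ≤ (B + 1) * (ε / 2 / (B + 1)) := by gcongr; exact (hv m).1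
      _ = ε / 2 := by field_simp
  have b2 : ‖T (v m) - v m‖ ≤ h / ‖μ‖ * (B * L) := by
    rw [hdom, norm_smul, norm_inv, norm_div, Complex.norm_real, Real.norm_of_nonneg hh.le, inv_div]
    gcongr
    exact T.le_of_opNorm_le_of_le hT (hv m).2
  rw [split]
  linarith [norm_add_le (T (w m - v m) - (w m - v m)) (T (v m) - v m)]

/-- Along a consistent approximating family, `A m (P m x)` is uniformly approximated by vectors
of the domains with bounded images. -/
theorem exists_uniform_domain_approx {X : Type*} [NormedAddCommGroup X] [NormedSpace ℂ X]
    {P : ∀ m, X →L[ℂ] Z m} {J : ∀ m, Z m →L[ℂ] X} (hPJ : ∀ m (y : Z m), P m (J m y) = y)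
    {K : ℝ} (hK : 0 < K) (hP : ∀ m, ‖P m‖ ≤ K)
    {A : X →ₗ.[ℂ] X} (hA : Dense (A.domain : Set X))
    {Am : ∀ m, Z m →ₗ.[ℂ] Z m} (hAm : ∀ m, Dense ((Am m).domain : Set (Z m)))
    (hPdom : ∀ m, ∀ x ∈ A.domain, P m x ∈ (Am m).domain)
    (hcons : ∀ x : A.domain,
      Tendsto (fun m => J m ((Am m) ⟨P m (x : X), hPdom m x x.2⟩)) atTop (𝓝 (A x)))
    (x : A.domain) {ε : ℝ} (hε : 0 < ε) :
    ∃ (v : ∀ m, (Am m).domain) (L : ℝ),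
      ∀ m, ‖Am m ⟨P m (x : X), hPdom m x x.2⟩ - v m‖ ≤ ε ∧ ‖Am m (v m)‖ ≤ L := by
  have hPle : ∀ m (y : Z m) (u : X), ‖y - P m u‖ ≤ K * ‖J m y - u‖ := fun m y u => by
    simpa only [map_sub, hPJ] using (P m).le_of_opNorm_le (hP m) (J m y - u)
  obtain ⟨z, hz, hzd⟩ := hA.exists_dist_lt (A x) (show 0 < ε / 2 / K by positivity)
  have hclose : ∀ᶠ m in atTop,
      ‖Am m ⟨P m (x : X), hPdom m x x.2⟩ - P m z‖ ≤ ε := by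
    filter_upwards [(Metric.tendsto_nhds.1 (hcons x)) (ε / 2 / K) (by positivity)] with m hm
    calc _ ≤ K * ‖J m (Am m ⟨P m (x : X), hPdom m x x.2⟩) - z‖ := hPle m _ _
      _ ≤ K * (ε / 2 / K + ε / 2 / K) := by
        gcongr
        rw [← dist_eq_norm]
        exact (dist_triangle _ (A x) _).trans (add_le_add hm.le hzd.le)
      _ = ε := by field_simp; norm_num
  have hex : ∀ m, ∃ v : (Am m).domain, ‖Am m ⟨P m (x : X), hPdom m x x.2⟩ - v‖ ≤ ε ∧
      (‖Am m ⟨P m (x : X), hPdom m x x.2⟩ - P m z‖ ≤ ε → v = ⟨P m z, hPdom m z hz⟩) := by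
    intro m
    by_cases h : ‖Am m ⟨P m (x : X), hPdom m x x.2⟩ - P m z‖ ≤ ε
    · exact ⟨⟨P m z, hPdom m z hz⟩, h, fun _ => rfl⟩
    · obtain ⟨v, hv, hvd⟩ := (hAm m).exists_dist_lt (Am m ⟨P m (x : X), hPdom m x x.2⟩) hε
      exact ⟨⟨v, hv⟩, by simpa [dist_eq_norm] using hvd.le, fun h' => absurd h' h⟩
  choose v hv hvz using hex
  have hbdd : BddAbove (Set.range fun m => ‖Am m (v m)‖) := by
    have hlim := ((hcons ⟨z, hz⟩).norm.const_mul K).isBoundedUnder_le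
    refine Filter.IsBoundedUnder.bddAbove_range (hlim.mono_le ?_)
    filter_upwards [hclose] with m hm
    rw [hvz m hm]
    simpa using hPle m (Am m ⟨P m z, hPdom m z hz⟩) 0
  obtain ⟨L, hL⟩ := hbdd
  exact ⟨v, L, fun m => ⟨hv m, hL ⟨m, rfl⟩⟩⟩

end Family

/-- **Key Lemma on rational approximations.**
For an approximation scheme, a stable and consistent approximating family `A, A m`, and
a rational function `r` with `r(0) = r'(0) = 1` which is bounded on the closed left
half-plane, given by its partial fraction decomposition with poles of positive real part,
for every `x ∈ D(A)`,
`‖(J m r(h A m) P m x − J m P m x)/h − J m A m P m x‖ → 0` as `h → 0+`, uniformly in `m`. -/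
theorem key_lemma_rational
    (X : Type*) [NormedAddCommGroup X] [NormedSpace ℂ X] [CompleteSpace X]
    (Xm : ℕ → Type*) [∀ m, NormedAddCommGroup (Xm m)] [∀ m, NormedSpace ℂ (Xm m)]
    [∀ m, CompleteSpace (Xm m)]
    -- the approximation scheme
    (P : ∀ m, X →L[ℂ] Xm m) (J : ∀ m, Xm m →L[ℂ] X)
    (hPJ : ∀ m (y : Xm m), P m (J m y) = y)
    (hJP : ∀ x : X, Tendsto (fun m => J m (P m x)) atTop (𝓝 x))
    (K : ℝ) (hK : 0 < K) (hJnorm : ∀ m, ‖J m‖ ≤ K) (hPnorm : ∀ m, ‖P m‖ ≤ K)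
    -- the operators: closed and densely defined
    (A : X →ₗ.[ℂ] X) (hAclosed : IsClosed (A.graph : Set (X × X)))
    (hAdense : Dense (A.domain : Set X))
    (Am : ∀ m, Xm m →ₗ.[ℂ] Xm m)
    (hAmclosed : ∀ m, IsClosed ((Am m).graph : Set (Xm m × Xm m)))
    (hAmdense : ∀ m, Dense ((Am m).domain : Set (Xm m)))
    -- stability
    (RA : ℂ → X →L[ℂ] X) (RAm : ∀ m, ℂ → Xm m →L[ℂ] Xm m) (M : ℝ) (hM : 0 ≤ M)
    (hRA : ∀ lam : ℂ, 0 < lam.re → IsResolvent A lam (RA lam) ∧ lam.re * ‖RA lam‖ ≤ M)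
    (hRAm : ∀ m, ∀ lam : ℂ, 0 < lam.re →
      IsResolvent (Am m) lam (RAm m lam) ∧ lam.re * ‖RAm m lam‖ ≤ M)
    -- consistency
    (hPdom : ∀ m, ∀ x ∈ A.domain, P m x ∈ (Am m).domain)
    (hcons : ∀ x : A.domain,
      Tendsto (fun m => J m ((Am m) ⟨P m (x : X), hPdom m x x.2⟩)) atTop (𝓝 (A x)))
    -- the rational function, given through its partial fraction decomposition
    (l : ℕ) (ν : Fin l → ℕ) (hν : ∀ i, 1 ≤ ν i) (lam : Fin l → ℂ) (C : Fin l → ℕ → ℂ)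
    (hlam : ∀ i, 0 < (lam i).re)
    (hr0 : pfdFun l ν lam C 0 = 1)
    (hr1 : HasDerivAt (pfdFun l ν lam C) 1 0)
    (hbdd : ∃ Cb : ℝ, ∀ z : ℂ, z.re ≤ 0 → ‖pfdFun l ν lam C z‖ ≤ Cb) :
    ∀ x : A.domain, ∀ ε > (0 : ℝ), ∃ δ > (0 : ℝ), ∀ h : ℝ, 0 < h → h < δ → ∀ m : ℕ,
      ‖((h : ℂ))⁻¹ • (J m (ratOp l ν lam C (RAm m) h (P m (x : X))) - J m (P m (x : X)))
        - J m ((Am m) ⟨P m (x : X), hPdom m x x.2⟩)‖ ≤ ε := by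
  intro x ε hε
  have hlam0 : ∀ i, lam i ≠ 0 := fun i hi => by simpa [hi] using hlam i
  have h0 := (pfdFun_zero l ν lam C).symm.trans hr0
  have h1 := (hasDerivAt_pfdFun_zero l ν lam C).unique hr1
  set B : Fin l → ℝ := fun i => ‖lam i‖ / (lam i).re * M
  have hB : ∀ i, 0 ≤ B i := fun i =>
    mul_nonneg (div_nonneg (norm_nonneg _) (hlam i).le) hM
  set D : ℝ := ∑ i, ∑ j ∈ Finset.Icc 1 (ν i), ‖C i j / lam i‖ *
    ∑ k ∈ Finset.range j, ∑ n ∈ Finset.range (k + 1), B i ^ n with hD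
  have hD0 : 0 ≤ D := Finset.sum_nonneg fun i _ => Finset.sum_nonneg fun j _ =>
    mul_nonneg (norm_nonneg _) (Finset.sum_nonneg fun k _ => Finset.sum_nonneg fun n _ =>
      pow_nonneg (hB i) n)
  have hev : ∀ᶠ h : ℝ in 𝓝[>] 0, ∀ i, ∀ m,
      ‖((lam i / (h : ℂ)) • RAm m (lam i / h)) (Am m ⟨P m (x : X), hPdom m x x.2⟩) -
        Am m ⟨P m (x : X), hPdom m x x.2⟩‖ ≤ ε / (K * (D + 1)) :=
    eventually_all.2 fun i => eventually_norm_smul_resolvent_sub_le hM hRAm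
      (fun η hη => exists_uniform_domain_approx hPJ hK hPnorm hAdense hAmdense hPdom hcons x hη)
      (hlam i) (by positivity)
  obtain ⟨δ, hδ, hsub⟩ := mem_nhdsGT_iff_exists_Ioo_subset.1 hev
  refine ⟨δ, hδ, fun h hh hhδ m => ?_⟩
  have hest := hsub ⟨hh, hhδ⟩
  have hre : ∀ i, 0 < (lam i / (h : ℂ)).re := fun i => by
    rw [Complex.div_ofReal_re]
    exact div_pos (hlam i) hh
  have key := ratOp_difference_quotient_sub hh hlam0 (fun i => (hRAm m _ (hre i)).1) h0 h1
    ⟨P m (x : X), hPdom m x x.2⟩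
  have bound : ‖(h : ℂ)⁻¹ • (ratOp l ν lam C (RAm m) h (P m (x : X)) - P m (x : X)) -
      Am m ⟨P m (x : X), hPdom m x x.2⟩‖ ≤ D * (ε / (K * (D + 1))) := by
    rw [key, hD, Finset.sum_mul]
    refine norm_sum_le_of_le _ fun i _ => ?_
    rw [Finset.sum_mul]
    refine norm_sum_le_of_le _ fun j _ => ?_
    rw [norm_smul, mul_assoc, Finset.sum_mul]
    gcongr
    refine norm_sum_le_of_le _ fun k _ => ?_
    refine (ContinuousLinearMap.norm_pow_apply_sub_self_le (hB i)
      (norm_div_smul_le (hlam i) hh (hRAm m _ (hre i)).2) _ _).trans ?_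
    exact mul_le_mul_of_nonneg_left (hest i m)
      (Finset.sum_nonneg fun n _ => pow_nonneg (hB i) n)
  rw [← map_sub, ← map_smul, ← map_sub]
  calc _ ≤ K * (D * (ε / (K * (D + 1)))) := (J m).le_of_opNorm_le_of_le (hJnorm m) bound
    _ = ε * (D / (D + 1)) := by field_simp
    _ ≤ ε * 1 := by
      gcongr
      exact (div_le_one (by positivity)).2 (by linarith)
    _ = ε := mul_one ε
end

section
/- Backward Euler case of the Key Lemma: Let X, X_m, P_m, J_m form an approximation scheme and let A, A_m be a stable and consistent approximating family of operators. Then for every x ∈ D(A), ‖(1/h)·( (1/h) J_m R(1/h, A_m) P_m x − J_m P_m x ) − J_m A_m P_m x‖ → 0 as h → 0+, uniformly in m ∈ ℕ. (Equivalently, ‖J_m ( (1/h) R(1/h, A_m) − I_m ) A_m P_m x‖ → 0 as h → 0+ uniformly in m.) -/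
open Filter Topology

namespace IsResolvent

variable {Y : Type*} [NormedAddCommGroup Y] [NormedSpace ℂ Y]
  {A : Y →ₗ.[ℂ] Y} {lam : ℂ} {R : Y →L[ℂ] Y}

/-- On the domain of `A`, the resolvent satisfies `lam R(lam, A) z - z = R(lam, A) A z`. -/
theorem smul_apply_sub (hR : IsResolvent A lam R) (z : A.domain) :
    lam • R (z : Y) - z = R (A z) := by
  have h := hR.eq_left z
  rw [map_sub, map_smul] at h
  rw [sub_eq_iff_eq_add, add_comm, ← sub_eq_iff_eq_add, h]

/-- The error of the backward Euler approximation of the identity at `y`, estimated through an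
element `z` of the domain. -/
theorem norm_smul_apply_sub_le (hR : IsResolvent A lam R) {M h : ℝ}
    (hlam : ‖lam‖ * ‖R‖ ≤ M) (hnorm : ‖R‖ ≤ h * M) (y : Y) (z : A.domain) :
    ‖lam • R y - y‖ ≤ (M + 1) * ‖y - z‖ + h * M * ‖A z‖ := by
  have hsplit : lam • R y - y = (lam • R (y - z) - (y - z)) + R (A z) := by
    rw [← hR.smul_apply_sub z, map_sub, smul_sub]
    abel
  have h1 : ‖lam • R (y - z)‖ ≤ M * ‖y - z‖ := by
    rw [norm_smul]
    calc ‖lam‖ * ‖R (y - z)‖ ≤ ‖lam‖ * (‖R‖ * ‖y - z‖) := by gcongr; exact R.le_opNorm _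
      _ = ‖lam‖ * ‖R‖ * ‖y - z‖ := by ring
      _ ≤ M * ‖y - z‖ := by gcongr
  have h2 : ‖R (A z)‖ ≤ h * M * ‖A z‖ := R.le_of_opNorm_le hnorm _
  rw [hsplit]
  calc _ ≤ ‖lam • R (y - z)‖ + ‖y - z‖ + ‖R (A z)‖ :=
        (norm_add_le _ _).trans (by gcongr; exact norm_sub_le _ _)
    _ ≤ M * ‖y - z‖ + ‖y - z‖ + h * M * ‖A z‖ := by gcongr
    _ = _ := by ring

end IsResolvent

/-- A sequence of nonnegative reals which is eventually bounded by a constant is bounded. -/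
theorem exists_nonneg_forall_le_of_eventually_le {f : ℕ → ℝ} {C : ℝ}
    (hf : ∀ᶠ m in atTop, f m ≤ C) : ∃ B, 0 ≤ B ∧ ∀ m, f m ≤ B := by
  have hb : IsBoundedUnder (· ≤ ·) atTop f := ⟨C, hf⟩
  obtain ⟨B, hB⟩ := hb.bddAbove_range
  exact ⟨max B 0, le_max_right _ _, fun m => (hB ⟨m, rfl⟩).trans (le_max_left _ _)⟩

/-- **Backward Euler case of the Key Lemma.**
For an approximation scheme `(P m, J m, K)` and a stable and consistent approximating
family `A, A m` (with resolvents `RA`, `RAm`), for every `x ∈ D(A)` one has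
`‖(1/h)·((1/h) J m R(1/h, A m) P m x − J m P m x) − J m A m P m x‖ → 0` as `h → 0+`,
uniformly in `m ∈ ℕ`. -/
theorem backward_euler_key_lemma
    (X : Type*) [NormedAddCommGroup X] [NormedSpace ℂ X] [CompleteSpace X]
    (Xm : ℕ → Type*) [∀ m, NormedAddCommGroup (Xm m)] [∀ m, NormedSpace ℂ (Xm m)]
    [∀ m, CompleteSpace (Xm m)]
    -- the approximation scheme
    (P : ∀ m, X →L[ℂ] Xm m) (J : ∀ m, Xm m →L[ℂ] X)
    (hPJ : ∀ m (y : Xm m), P m (J m y) = y)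
    (hJP : ∀ x : X, Tendsto (fun m => J m (P m x)) atTop (𝓝 x))
    (K : ℝ) (hK : 0 < K) (hJnorm : ∀ m, ‖J m‖ ≤ K) (hPnorm : ∀ m, ‖P m‖ ≤ K)
    -- the operators: closed and densely defined
    (A : X →ₗ.[ℂ] X) (hAclosed : IsClosed (A.graph : Set (X × X)))
    (hAdense : Dense (A.domain : Set X))
    (Am : ∀ m, Xm m →ₗ.[ℂ] Xm m)
    (hAmclosed : ∀ m, IsClosed ((Am m).graph : Set (Xm m × Xm m)))
    (hAmdense : ∀ m, Dense ((Am m).domain : Set (Xm m)))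
    -- stability: resolvents exist on the right half-plane and are uniformly bounded
    (RA : ℂ → X →L[ℂ] X) (RAm : ∀ m, ℂ → Xm m →L[ℂ] Xm m) (M : ℝ) (hM : 0 ≤ M)
    (hRA : ∀ lam : ℂ, 0 < lam.re → IsResolvent A lam (RA lam) ∧ lam.re * ‖RA lam‖ ≤ M)
    (hRAm : ∀ m, ∀ lam : ℂ, 0 < lam.re →
      IsResolvent (Am m) lam (RAm m lam) ∧ lam.re * ‖RAm m lam‖ ≤ M)
    -- consistency
    (hPdom : ∀ m, ∀ x ∈ A.domain, P m x ∈ (Am m).domain)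
    (hcons : ∀ x : A.domain,
      Tendsto (fun m => J m ((Am m) ⟨P m (x : X), hPdom m x x.2⟩)) atTop (𝓝 (A x))) :
    ∀ x : A.domain, ∀ ε > (0 : ℝ), ∃ δ > (0 : ℝ), ∀ h : ℝ, 0 < h → h < δ → ∀ m : ℕ,
      ‖((h : ℂ))⁻¹ • (((h : ℂ))⁻¹ • J m (RAm m ((h : ℂ))⁻¹ (P m (x : X)))
          - J m (P m (x : X)))
        - J m ((Am m) ⟨P m (x : X), hPdom m x x.2⟩)‖ ≤ ε := by
  intro x ε hε
  set y : ∀ m, Xm m := fun m => Am m ⟨P m (x : X), hPdom m x x.2⟩ with hy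
  have hle : ∀ m (w : Xm m) (u : X), ‖w - P m u‖ ≤ K * ‖J m w - u‖ := fun m w u => by
    have := (P m).le_of_opNorm_le (hPnorm m) (J m w - u)
    rwa [map_sub, hPJ] at this
  obtain ⟨η, hη, hηε⟩ : ∃ η > 0, K * ((M + 1) * η) = ε / 2 :=
    ⟨ε / 2 / (K * (M + 1)), by positivity, by field_simp⟩
  have happrox : ∃ C, 0 ≤ C ∧ ∀ m, ∃ z : (Am m).domain, ‖y m - z‖ ≤ η ∧ ‖Am m z‖ ≤ C := by
    obtain ⟨u, hu, hux⟩ := hAdense.exists_dist_lt (A x) (div_pos hη hK)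
    obtain ⟨B, hB⟩ : ∃ B, ∀ᶠ m in atTop, ‖Am m ⟨P m u, hPdom m u hu⟩‖ ≤ B := by
      refine ⟨K * (‖A ⟨u, hu⟩‖ + 1), ?_⟩
      filter_upwards [(hcons ⟨u, hu⟩).norm.eventually_le_const (lt_add_one _)] with m hm
      have := hle m (Am m ⟨P m u, hPdom m u hu⟩) 0
      rw [map_zero, sub_zero, sub_zero] at this
      exact this.trans (by gcongr)
    have hclose : ∀ᶠ m in atTop, ‖y m - P m u‖ ≤ η := by
      rw [dist_eq_norm] at hux
      filter_upwards [((hcons x).sub_const u).norm.eventually_le_const hux] with m hm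
      calc _ ≤ K * ‖J m (y m) - u‖ := hle m _ _
        _ ≤ K * (η / K) := by gcongr
        _ = η := by field_simp
    have hz : ∀ m, ∃ z : (Am m).domain, ‖y m - z‖ ≤ η ∧
        (‖y m - P m u‖ ≤ η → ‖Am m z‖ = ‖Am m ⟨P m u, hPdom m u hu⟩‖) := fun m => by
      by_cases hm : ‖y m - P m u‖ ≤ η
      · exact ⟨⟨P m u, hPdom m u hu⟩, hm, fun _ => rfl⟩
      · obtain ⟨z, hz, hyz⟩ := (hAmdense m).exists_dist_lt (y m) hη
        exact ⟨⟨z, hz⟩, by rw [← dist_eq_norm]; exact hyz.le, fun h => absurd h hm⟩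
    choose z hyz hAz using hz
    obtain ⟨C, hC, hzC⟩ := exists_nonneg_forall_le_of_eventually_le
      (f := fun m => ‖Am m (z m)‖) (C := B) <| by
        filter_upwards [hB, hclose] with m hm hm'
        rwa [hAz m hm']
    exact ⟨C, hC, fun m => ⟨z m, hyz m, hzC m⟩⟩
  obtain ⟨C, hC, hz⟩ := happrox
  obtain ⟨δ, hδ, hδε⟩ : ∃ δ > 0, K * (δ * (M * C + 1)) = ε / 2 :=
    ⟨ε / 2 / (K * (M * C + 1)), by positivity, by field_simp⟩
  refine ⟨δ, hδ, fun h h0 hhδ m => ?_⟩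
  have hre : ((h : ℂ)⁻¹).re = h⁻¹ := by rw [← Complex.ofReal_inv, Complex.ofReal_re]
  have hnlam : ‖(h : ℂ)⁻¹‖ = h⁻¹ := by
    rw [norm_inv, Complex.norm_real, Real.norm_of_nonneg h0.le]
  obtain ⟨hR, hRM⟩ := hRAm m (h : ℂ)⁻¹ (by rw [hre]; positivity)
  rw [hre] at hRM
  obtain ⟨z, hyz, hAz⟩ := hz m
  have hbound := hR.norm_smul_apply_sub_le (by rwa [hnlam])
    ((inv_mul_le_iff₀ h0).1 hRM) (y m) z
  have heq : (h : ℂ)⁻¹ • ((h : ℂ)⁻¹ • J m (RAm m (h : ℂ)⁻¹ (P m (x : X))) - J m (P m (x : X)))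
      - J m (y m) = J m ((h : ℂ)⁻¹ • RAm m (h : ℂ)⁻¹ (y m) - y m) := by
    rw [hy, ← hR.smul_apply_sub ⟨P m (x : X), hPdom m x x.2⟩]
    simp only [map_sub, map_smul]
  rw [heq]
  calc _ ≤ K * ‖(h : ℂ)⁻¹ • RAm m (h : ℂ)⁻¹ (y m) - y m‖ := (J m).le_of_opNorm_le (hJnorm m) _
    _ ≤ K * ((M + 1) * η + δ * (M * C + 1)) := by
        gcongr
        refine hbound.trans (add_le_add (by gcongr) ?_)
        calc h * M * ‖Am m z‖ ≤ δ * M * C := by gcongr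
          _ ≤ δ * (M * C + 1) := by linarith
    _ = ε := by rw [mul_add, hηε, hδε, add_halves]
end

section
/- Uniform resolvent convergence: Let X, X_m, P_m, J_m form an approximation scheme and let A, A_m be a stable and consistent approximating family of operators, and assume in addition that P_m D(A) is dense in X_m for every m ∈ ℕ. Then for every x ∈ X, λ · J_m R(λ, A_m) P_m x → J_m P_m x as λ → ∞ (λ real, λ > 0), uniformly in m ∈ ℕ. -/
open Filter Topology

theorem norm_smul_apply_sub_le {Y : Type*} [NormedAddCommGroup Y] [NormedSpace ℂ Y]
    {R : Y →L[ℂ] Y} {lam M : ℝ} (hlam : 0 < lam) (hR : lam * ‖R‖ ≤ M) (y : Y) :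
    ‖(lam : ℂ) • R y - y‖ ≤ (M + 1) * ‖y‖ :=
  calc ‖(lam : ℂ) • R y - y‖ ≤ ‖(lam : ℂ) • R y‖ + ‖y‖ := norm_sub_le _ _
    _ = lam * ‖R y‖ + ‖y‖ := by rw [norm_smul, Complex.norm_of_nonneg hlam.le]
    _ ≤ lam * (‖R‖ * ‖y‖) + ‖y‖ := by
        gcongr
        exact R.le_opNorm y
    _ = (lam * ‖R‖) * ‖y‖ + ‖y‖ := by ring
    _ ≤ M * ‖y‖ + ‖y‖ := by gcongr
    _ = (M + 1) * ‖y‖ := by ring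

theorem IsResolvent.norm_smul_sub_le {Y : Type*} [NormedAddCommGroup Y] [NormedSpace ℂ Y]
    {A : Y →ₗ.[ℂ] Y} {lam M : ℝ} {R : Y →L[ℂ] Y} (h : IsResolvent A lam R) (hlam : 0 < lam)
    (hR : lam * ‖R‖ ≤ M) (y : A.domain) :
    lam * ‖(lam : ℂ) • R y - (y : Y)‖ ≤ M * ‖A y‖ := by
  have hy : (lam : ℂ) • R y - (y : Y) = R (A y) := by
    have := h.eq_left y
    rw [map_sub, map_smul, sub_eq_iff_eq_add] at this
    rw [this]
    abel
  calc lam * ‖(lam : ℂ) • R y - (y : Y)‖ ≤ lam * (‖R‖ * ‖A y‖) := by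
        rw [hy]
        gcongr
        exact R.le_opNorm _
    _ = (lam * ‖R‖) * ‖A y‖ := by ring
    _ ≤ M * ‖A y‖ := by gcongr

/-- **Uniform resolvent convergence.**
For an approximation scheme and a stable and consistent approximating family `A, A m`,
if moreover `P m D(A)` is dense in `X m` for every `m`, then for every `x ∈ X`,
`λ · J m R(λ, A m) P m x → J m P m x` as `λ → ∞` (`λ` real positive), uniformly in `m`. -/
theorem uniform_resolvent_convergence
    (X : Type*) [NormedAddCommGroup X] [NormedSpace ℂ X] [CompleteSpace X]
    (Xm : ℕ → Type*) [∀ m, NormedAddCommGroup (Xm m)] [∀ m, NormedSpace ℂ (Xm m)]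
    [∀ m, CompleteSpace (Xm m)]
    -- the approximation scheme
    (P : ∀ m, X →L[ℂ] Xm m) (J : ∀ m, Xm m →L[ℂ] X)
    (hPJ : ∀ m (y : Xm m), P m (J m y) = y)
    (hJP : ∀ x : X, Tendsto (fun m => J m (P m x)) atTop (𝓝 x))
    (K : ℝ) (hK : 0 < K) (hJnorm : ∀ m, ‖J m‖ ≤ K) (hPnorm : ∀ m, ‖P m‖ ≤ K)
    -- the operators: closed and densely defined
    (A : X →ₗ.[ℂ] X) (hAclosed : IsClosed (A.graph : Set (X × X)))
    (hAdense : Dense (A.domain : Set X))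
    (Am : ∀ m, Xm m →ₗ.[ℂ] Xm m)
    (hAmclosed : ∀ m, IsClosed ((Am m).graph : Set (Xm m × Xm m)))
    (hAmdense : ∀ m, Dense ((Am m).domain : Set (Xm m)))
    -- stability
    (RA : ℂ → X →L[ℂ] X) (RAm : ∀ m, ℂ → Xm m →L[ℂ] Xm m) (M : ℝ) (hM : 0 ≤ M)
    (hRA : ∀ lam : ℂ, 0 < lam.re → IsResolvent A lam (RA lam) ∧ lam.re * ‖RA lam‖ ≤ M)
    (hRAm : ∀ m, ∀ lam : ℂ, 0 < lam.re →
      IsResolvent (Am m) lam (RAm m lam) ∧ lam.re * ‖RAm m lam‖ ≤ M)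
    -- consistency
    (hPdom : ∀ m, ∀ x ∈ A.domain, P m x ∈ (Am m).domain)
    (hcons : ∀ x : A.domain,
      Tendsto (fun m => J m ((Am m) ⟨P m (x : X), hPdom m x x.2⟩)) atTop (𝓝 (A x)))
    -- additionally, `P m D(A)` is dense in `X m`
    (hPD : ∀ m, Dense ((P m) '' (A.domain : Set X))) :
    ∀ x : X, ∀ ε > (0 : ℝ), ∃ Λ : ℝ, ∀ lam : ℝ, 0 < lam → Λ ≤ lam → ∀ m : ℕ,
      ‖((lam : ℂ)) • J m (RAm m (lam : ℂ) (P m x)) - J m (P m x)‖ ≤ ε := by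
  intro x ε hε
  have hKM : 0 < K * K * (M + 1) := by positivity
  obtain ⟨z, hz, hxz⟩ := Metric.mem_closure_iff.1 (hAdense x) (ε / 2 / (K * K * (M + 1)))
    (by positivity)
  rw [dist_eq_norm, lt_div_iff₀ hKM] at hxz
  obtain ⟨C, hC⟩ := (Metric.isBounded_range_of_tendsto _ (hcons ⟨z, hz⟩)).exists_norm_le
  have hC0 : 0 ≤ C := (norm_nonneg _).trans (hC _ (Set.mem_range_self 0))
  refine ⟨2 * (K * M * (K * C)) / ε, fun lam hlam hle m => ?_⟩
  obtain ⟨hres, hbound⟩ := hRAm m lam (by simpa using hlam)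
  rw [Complex.ofReal_re] at hbound
  rw [div_le_iff₀ hε] at hle
  have hAz : ‖Am m ⟨P m z, hPdom m z hz⟩‖ ≤ K * C := by
    rw [← hPJ m (Am m ⟨P m z, hPdom m z hz⟩)]
    exact (P m).le_of_opNorm_le_of_le (hPnorm m) (hC _ (Set.mem_range_self m))
  have hdom := hres.norm_smul_sub_le hlam hbound ⟨P m z, hPdom m z hz⟩
  have hPxz : ‖P m (x - z)‖ ≤ K * ‖x - z‖ := (P m).le_of_opNorm_le (hPnorm m) _
  have hsplit : (lam : ℂ) • J m (RAm m lam (P m x)) - J m (P m x) =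
      J m (((lam : ℂ) • RAm m lam (P m (x - z)) - P m (x - z)) +
        ((lam : ℂ) • RAm m lam (P m z) - P m z)) := by
    simp only [map_sub, map_add, map_smul, smul_sub]
    abel
  have hfirst : ‖(lam : ℂ) • RAm m lam (P m (x - z)) - P m (x - z)‖ ≤
      (M + 1) * (K * ‖x - z‖) :=
    (norm_smul_apply_sub_le hlam hbound _).trans (by gcongr)
  have hsecond : K * ‖(lam : ℂ) • RAm m lam (P m z) - P m z‖ ≤ ε / 2 := by
    refine le_of_mul_le_mul_left ?_ hlam
    have : K * (lam * ‖(lam : ℂ) • RAm m lam (P m z) - P m z‖) ≤ K * (M * (K * C)) :=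
      mul_le_mul_of_nonneg_left (hdom.trans (by gcongr)) hK.le
    linarith
  rw [hsplit]
  calc _ ≤ K * (‖(lam : ℂ) • RAm m lam (P m (x - z)) - P m (x - z)‖ +
        ‖(lam : ℂ) • RAm m lam (P m z) - P m z‖) :=
        (J m).le_of_opNorm_le_of_le (hJnorm m) (norm_add_le _ _)
    _ ≤ K * ((M + 1) * (K * ‖x - z‖)) + ε / 2 := by
        rw [mul_add]
        gcongr
    _ ≤ ε := by linarith
end

section
/- Iterated backward Euler case of the Key Lemma: Let X, X_m, P_m, J_m form an approximation scheme, let A, A_m be a stable and consistent approximating family of operators, and fix k ∈ ℕ, k ≥ 1. Then for every x ∈ D(A), ‖(1/h)·( J_m [ (k/h) R(k/h, A_m) ]^{k} P_m x − J_m P_m x ) − J_m A_m P_m x‖ → 0 as h → 0+, uniformly in m ∈ ℕ. -/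
open Filter Topology

namespace IsResolvent

variable {Y : Type*} [NormedAddCommGroup Y] [NormedSpace ℂ Y] {A : Y →ₗ.[ℂ] Y} {lam : ℂ}
  {R : Y →L[ℂ] Y}

theorem smul_apply_sub_self_s4 (hR : IsResolvent A lam R) (y : A.domain) :
    (lam • R) (y : Y) - (y : Y) = R (A y) := by
  have h := hR.eq_left y
  rw [map_sub, map_smul, sub_eq_iff_eq_add] at h
  rw [smul_apply, h]
  abel

theorem norm_smul_apply_sub_self_le {t M : ℝ} (ht : 0 < t) (hR : IsResolvent A (t : ℂ) R)
    (hM : t * ‖R‖ ≤ M) (z : Y) (y : A.domain) :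
    ‖((t : ℂ) • R) z - z‖ ≤ (M + 1) * ‖z - y‖ + M / t * ‖A y‖ := by
  have hT : ‖(t : ℂ) • R‖ ≤ M := by
    rwa [norm_smul, Complex.norm_real, Real.norm_of_nonneg ht.le]
  have hRt : ‖R‖ ≤ M / t := by rwa [le_div_iff₀' ht]
  have hsplit : ((t : ℂ) • R) z - z = ((t : ℂ) • R) (z - y) - (z - y) + R (A y) := by
    rw [← hR.smul_apply_sub_self_s4 y, map_sub]
    abel
  calc ‖((t : ℂ) • R) z - z‖
      ≤ ‖((t : ℂ) • R) (z - y)‖ + ‖z - y‖ + ‖R (A y)‖ := by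
        rw [hsplit]
        exact (norm_add_le _ _).trans (by gcongr; exact norm_sub_le _ _)
    _ ≤ M * ‖z - y‖ + ‖z - y‖ + M / t * ‖A y‖ := by
        gcongr
        · exact ContinuousLinearMap.le_of_opNorm_le _ hT _
        · exact ContinuousLinearMap.le_of_opNorm_le _ hRt _
    _ = _ := by ring

end IsResolvent

section Powers

variable {Y : Type*} [NormedAddCommGroup Y] [NormedSpace ℂ Y] {T : Y →L[ℂ] Y} {M : ℝ}

theorem norm_pow_apply_sub_self_le (hM : 0 ≤ M) (hT : ‖T‖ ≤ M) (z : Y) (n : ℕ) :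
    ‖(T ^ n) z - z‖ ≤ (∑ i ∈ Finset.range n, M ^ i) * ‖T z - z‖ := by
  induction n with
  | zero => simp
  | succ n ih =>
    have hsplit : (T ^ (n + 1)) z - z = T ((T ^ n) z - z) + (T z - z) := by
      rw [pow_succ', mul_apply_eq_comp, map_sub]
      abel
    calc ‖(T ^ (n + 1)) z - z‖
        ≤ ‖T ((T ^ n) z - z)‖ + ‖T z - z‖ := hsplit ▸ norm_add_le _ _
      _ ≤ M * ((∑ i ∈ Finset.range n, M ^ i) * ‖T z - z‖) + ‖T z - z‖ := by
        gcongr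
        exact (ContinuousLinearMap.le_of_opNorm_le _ hT _).trans (by gcongr)
      _ = _ := by rw [geom_sum_succ]; ring

theorem pow_apply_sub_self_eq_sum {y a : Y} {c : ℂ} (h : T y - y = c • T a) (n : ℕ) :
    (T ^ n) y - y = c • ∑ j ∈ Finset.range n, (T ^ (j + 1)) a := by
  induction n with
  | zero => simp
  | succ n ih =>
    have hstep : (T ^ (n + 1)) y - (T ^ n) y = c • (T ^ (n + 1)) a := by
      rw [pow_succ, mul_apply_eq_comp, mul_apply_eq_comp, ← map_sub, h,
        map_smul]
    rw [Finset.sum_range_succ, smul_add, ← ih, ← hstep]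
    abel

theorem norm_inv_smul_pow_apply_sub_self_sub_le (hM : 0 ≤ M) (hT : ‖T‖ ≤ M) {y a : Y} {c : ℂ}
    (hc : c ≠ 0) (h : T y - y = c • T a) {n : ℕ} (hn : n ≠ 0) :
    ‖((n : ℂ) * c)⁻¹ • ((T ^ n) y - y) - a‖ ≤
      (∑ i ∈ Finset.range n, M ^ i) * ‖T a - a‖ := by
  have hn' : (n : ℂ) ≠ 0 := Nat.cast_ne_zero.mpr hn
  have hn0 : (0 : ℝ) < n := by positivity
  have heq : ((n : ℂ) * c)⁻¹ • ((T ^ n) y - y) - a =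
      (n : ℂ)⁻¹ • ∑ j ∈ Finset.range n, ((T ^ (j + 1)) a - a) := by
    rw [pow_apply_sub_self_eq_sum h, smul_smul, mul_inv, mul_assoc, inv_mul_cancel₀ hc, mul_one,
      Finset.sum_sub_distrib, smul_sub, Finset.sum_const, Finset.card_range,
      ← Nat.cast_smul_eq_nsmul ℂ, inv_smul_smul₀ hn']
  rw [heq, norm_smul, norm_inv, Complex.norm_natCast, inv_mul_le_iff₀ hn0]
  calc ‖∑ j ∈ Finset.range n, ((T ^ (j + 1)) a - a)‖
      ≤ ∑ j ∈ Finset.range n, (∑ i ∈ Finset.range n, M ^ i) * ‖T a - a‖ := by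
        refine norm_sum_le_of_le _ fun j hj => ?_
        refine (norm_pow_apply_sub_self_le hM hT a (j + 1)).trans ?_
        have hjn : j + 1 ≤ n := Finset.mem_range.mp hj
        gcongr
    _ = _ := by simp

end Powers

/-- Along a consistent family, a sequence `z m ∈ Xm m` with `J m (z m)` convergent is uniformly
approximated by elements of the domains whose images under `Am m` are bounded. -/
theorem exists_approx_mem_domain_bounded
    {X : Type*} [NormedAddCommGroup X] [NormedSpace ℂ X]
    {Xm : ℕ → Type*} [∀ m, NormedAddCommGroup (Xm m)] [∀ m, NormedSpace ℂ (Xm m)]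
    {P : ∀ m, X →L[ℂ] Xm m} {J : ∀ m, Xm m →L[ℂ] X}
    (hPJ : ∀ m (y : Xm m), P m (J m y) = y)
    {K : ℝ} (hK : 0 < K) (hPnorm : ∀ m, ‖P m‖ ≤ K)
    {A : X →ₗ.[ℂ] X} (hAdense : Dense (A.domain : Set X))
    {Am : ∀ m, Xm m →ₗ.[ℂ] Xm m} (hAmdense : ∀ m, Dense ((Am m).domain : Set (Xm m)))
    (hPdom : ∀ m, ∀ x ∈ A.domain, P m x ∈ (Am m).domain)
    (hcons : ∀ x : A.domain,
      Tendsto (fun m => J m ((Am m) ⟨P m (x : X), hPdom m x x.2⟩)) atTop (𝓝 (A x)))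
    {z : ∀ m, Xm m} {w : X} (hz : Tendsto (fun m => J m (z m)) atTop (𝓝 w))
    {η : ℝ} (hη : 0 < η) :
    ∃ y : ∀ m, (Am m).domain, (∀ m, ‖z m - y m‖ ≤ η) ∧ ∃ C : ℝ, ∀ m, ‖Am m (y m)‖ ≤ C := by
  have hPle : ∀ m (u : X), ‖P m u‖ ≤ K * ‖u‖ :=
    fun m u => ContinuousLinearMap.le_of_opNorm_le _ (hPnorm m) u
  obtain ⟨v, hv, hvw⟩ := hAdense.exists_dist_lt w (div_pos hη hK)
  have hnear : ∀ᶠ m in atTop, ‖z m - P m v‖ ≤ η := by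
    have hlim : Tendsto (fun m => dist (J m (z m)) v) atTop (𝓝 (dist w v)) :=
      hz.dist tendsto_const_nhds
    filter_upwards [hlim.eventually_lt_const hvw] with m hm
    calc ‖z m - P m v‖ = ‖P m (J m (z m) - v)‖ := by rw [map_sub, hPJ]
      _ ≤ K * ‖J m (z m) - v‖ := hPle m _
      _ ≤ K * (η / K) := by rw [← dist_eq_norm]; gcongr
      _ = η := by field_simp
  have hexists : ∀ m, ∃ y : (Am m).domain,
      ‖z m - y‖ ≤ η ∧ (‖z m - P m v‖ ≤ η → y = ⟨P m v, hPdom m v hv⟩) := by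
    intro m
    by_cases hm : ‖z m - P m v‖ ≤ η
    · exact ⟨⟨P m v, hPdom m v hv⟩, hm, fun _ => rfl⟩
    · obtain ⟨u, hu, huz⟩ := (hAmdense m).exists_dist_lt (z m) hη
      exact ⟨⟨u, hu⟩, by rw [← dist_eq_norm]; exact huz.le, fun h => absurd h hm⟩
  choose y hy hyP using hexists
  refine ⟨y, hy, ?_⟩
  have hbdd : IsBoundedUnder (· ≤ ·) atTop fun m => ‖Am m (y m)‖ := by
    obtain ⟨C, hC⟩ := (hcons ⟨v, hv⟩).norm.isBoundedUnder_le
    refine ⟨K * C, ?_⟩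
    rw [eventually_map] at hC ⊢
    filter_upwards [hC, hnear] with m hm hmn
    rw [hyP m hmn, ← hPJ m (Am m _)]
    exact (hPle m _).trans (by gcongr)
  obtain ⟨C, hC⟩ := hbdd.bddAbove_range
  exact ⟨C, fun m => hC ⟨m, rfl⟩⟩

/-- **Iterated backward Euler case of the Key Lemma.**
For an approximation scheme, a stable and consistent approximating family `A, A m`, and
a fixed `k ≥ 1`, for every `x ∈ D(A)` one has
`‖(1/h)·(J m [(k/h) R(k/h, A m)]^k P m x − J m P m x) − J m A m P m x‖ → 0` as `h → 0+`,
uniformly in `m ∈ ℕ`. -/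
theorem iterated_backward_euler_key_lemma
    (X : Type*) [NormedAddCommGroup X] [NormedSpace ℂ X] [CompleteSpace X]
    (Xm : ℕ → Type*) [∀ m, NormedAddCommGroup (Xm m)] [∀ m, NormedSpace ℂ (Xm m)]
    [∀ m, CompleteSpace (Xm m)]
    -- the approximation scheme
    (P : ∀ m, X →L[ℂ] Xm m) (J : ∀ m, Xm m →L[ℂ] X)
    (hPJ : ∀ m (y : Xm m), P m (J m y) = y)
    (hJP : ∀ x : X, Tendsto (fun m => J m (P m x)) atTop (𝓝 x))
    (K : ℝ) (hK : 0 < K) (hJnorm : ∀ m, ‖J m‖ ≤ K) (hPnorm : ∀ m, ‖P m‖ ≤ K)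
    -- the operators: closed and densely defined
    (A : X →ₗ.[ℂ] X) (hAclosed : IsClosed (A.graph : Set (X × X)))
    (hAdense : Dense (A.domain : Set X))
    (Am : ∀ m, Xm m →ₗ.[ℂ] Xm m)
    (hAmclosed : ∀ m, IsClosed ((Am m).graph : Set (Xm m × Xm m)))
    (hAmdense : ∀ m, Dense ((Am m).domain : Set (Xm m)))
    -- stability
    (RA : ℂ → X →L[ℂ] X) (RAm : ∀ m, ℂ → Xm m →L[ℂ] Xm m) (M : ℝ) (hM : 0 ≤ M)
    (hRA : ∀ lam : ℂ, 0 < lam.re → IsResolvent A lam (RA lam) ∧ lam.re * ‖RA lam‖ ≤ M)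
    (hRAm : ∀ m, ∀ lam : ℂ, 0 < lam.re →
      IsResolvent (Am m) lam (RAm m lam) ∧ lam.re * ‖RAm m lam‖ ≤ M)
    -- consistency
    (hPdom : ∀ m, ∀ x ∈ A.domain, P m x ∈ (Am m).domain)
    (hcons : ∀ x : A.domain,
      Tendsto (fun m => J m ((Am m) ⟨P m (x : X), hPdom m x x.2⟩)) atTop (𝓝 (A x)))
    -- the number of iterations
    (k : ℕ) (hk : 1 ≤ k) :
    ∀ x : A.domain, ∀ ε > (0 : ℝ), ∃ δ > (0 : ℝ), ∀ h : ℝ, 0 < h → h < δ → ∀ m : ℕ,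
      ‖((h : ℂ))⁻¹ •
          (J m (((((k : ℂ) / (h : ℂ)) • RAm m ((k : ℂ) / (h : ℂ))) ^ k) (P m (x : X)))
            - J m (P m (x : X)))
        - J m ((Am m) ⟨P m (x : X), hPdom m x x.2⟩)‖ ≤ ε := by
  intro x ε hε
  set z : ∀ m, Xm m := fun m => Am m ⟨P m (x : X), hPdom m x x.2⟩
  set G : ℝ := ∑ i ∈ Finset.range k, M ^ i
  have hk0 : k ≠ 0 := Nat.one_le_iff_ne_zero.mp hk
  have hkpos : (0 : ℝ) < k := by positivity
  have hGpos : 0 < G := geom_sum_pos hM hk0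
  set d : ℝ := ε / (K * G) with hd
  have hdpos : 0 < d := by positivity
  obtain ⟨y, hy, C, hC⟩ := exists_approx_mem_domain_bounded hPJ hK hPnorm hAdense hAmdense hPdom
    hcons (hcons x) (η := d / (2 * (M + 1))) (by positivity)
  have hCnonneg : 0 ≤ C := (norm_nonneg _).trans (hC 0)
  refine ⟨d * k / (2 * (M * C + 1)), by positivity, fun h hh hhδ m => ?_⟩
  have ht : 0 < (k : ℝ) / h := by positivity
  have hcast : (k : ℂ) / (h : ℂ) = (((k : ℝ) / h : ℝ) : ℂ) := by push_cast; rfl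
  rw [hcast]
  set t : ℝ := (k : ℝ) / h with ht_def
  obtain ⟨hR, hRM⟩ := hRAm m (t : ℂ) (by simpa using ht)
  rw [Complex.ofReal_re] at hRM
  set T : Xm m →L[ℂ] Xm m := (t : ℂ) • RAm m (t : ℂ) with hT_def
  have hT : ‖T‖ ≤ M := by
    rwa [hT_def, norm_smul, Complex.norm_real, Real.norm_of_nonneg ht.le]
  have htne : (t : ℂ) ≠ 0 := Complex.ofReal_ne_zero.mpr ht.ne'
  have hstep : T (P m (x : X)) - P m (x : X) = (t : ℂ)⁻¹ • T (z m) := by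
    refine Eq.trans ?_ (inv_smul_smul₀ htne (RAm m (t : ℂ) (z m))).symm
    exact hR.smul_apply_sub_self_s4 ⟨P m (x : X), hPdom m x x.2⟩
  have hTz : ‖T (z m) - z m‖ ≤ d := by
    have hMC : M / t * C ≤ d / 2 := by
      rw [lt_div_iff₀ (by positivity)] at hhδ
      have hMt : M / t * C = h * (M * C) / k := by rw [ht_def]; field_simp
      rw [hMt, div_le_iff₀ hkpos]
      linarith
    calc ‖T (z m) - z m‖ ≤ (M + 1) * ‖z m - y m‖ + M / t * ‖Am m (y m)‖ :=
          hR.norm_smul_apply_sub_self_le ht hRM (z m) (y m)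
      _ ≤ (M + 1) * (d / (2 * (M + 1))) + M / t * C := by
          gcongr
          · exact hy m
          · exact hC m
      _ ≤ d / 2 + d / 2 := by
          gcongr
          exact le_of_eq (by field_simp)
      _ = d := add_halves d
  have hinv : (h : ℂ)⁻¹ = ((k : ℂ) * (t : ℂ)⁻¹)⁻¹ := by
    have hkc : (k : ℂ) ≠ 0 := Nat.cast_ne_zero.mpr hk0
    rw [← hcast, inv_div, mul_div_cancel₀ _ hkc]
  have hmain : ‖(h : ℂ)⁻¹ • ((T ^ k) (P m (x : X)) - P m (x : X)) - z m‖ ≤ G * d := by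
    rw [hinv]
    exact (norm_inv_smul_pow_apply_sub_self_sub_le hM hT (inv_ne_zero htne) hstep hk0).trans
      (by gcongr)
  rw [← map_sub, ← map_smul, ← map_sub]
  calc _ ≤ K * (G * d) := (ContinuousLinearMap.le_of_opNorm_le _ (hJnorm m) _).trans (by gcongr)
    _ = ε := by rw [hd]; field_simp
end

section
/- Convergence of the sequential splitting with spatial and rational temporal discretization: Let X, X_m, P_m, J_m form an approximation scheme, let A, A_m and B, B_m each be stable and consistent approximating families of operators, and suppose A and B generate strongly continuous semigroups on X and that the closure of A + B (with domain containing D(A) ∩ D(B)) generates a strongly continuous semigroup (U(t))_{t≥0} on X. Let r and q be rational functions with r(0) = r'(0) = 1, q(0) = q'(0) = 1, bounded on ℂ₋, with r(hA_m), q(hB_m) defined via partial fraction decompositions. Suppose there exist M ≥ 1 and ω ∈ ℝ such that ‖[ q(h B_m) r(h A_m) ]^{k}‖ ≤ M e^{khω} for all h > 0 and all k, m ∈ ℕ. Then for every x ∈ X, lim_{m,n→∞} J_m [ q((t/n) B_m) r((t/n) A_m) ]^{n} P_m x = U(t)x, uniformly for t in compact intervals of [0,∞). -/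
open Filter Topology

/-- `(T t)_{t ≥ 0}` is a strongly continuous semigroup of bounded linear operators. -/
def IsC0Semigroup {Y : Type*} [NormedAddCommGroup Y] [NormedSpace ℂ Y]
    (T : ℝ → Y →L[ℂ] Y) : Prop :=
  T 0 = 1 ∧ (∀ s t : ℝ, 0 ≤ s → 0 ≤ t → T (s + t) = T s * T t) ∧
    ∀ x : Y, ContinuousOn (fun t : ℝ => T t x) (Set.Ici 0)

/-- The graph of the generator of a semigroup `T`: pairs `(x, y)` such that
`(T h x - x)/h → y` as `h → 0+`. -/
def generatorGraph {Y : Type*} [NormedAddCommGroup Y] [NormedSpace ℂ Y]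
    (T : ℝ → Y →L[ℂ] Y) : Set (Y × Y) :=
  {p | Tendsto (fun h : ℝ => ((h : ℂ))⁻¹ • (T h p.1 - p.1)) (𝓝[>] (0 : ℝ)) (𝓝 p.2)}

/-- The operator `A` generates the strongly continuous semigroup `T`. -/
def IsGenerator {Y : Type*} [NormedAddCommGroup Y] [NormedSpace ℂ Y]
    (A : Y →ₗ.[ℂ] Y) (T : ℝ → Y →L[ℂ] Y) : Prop :=
  IsC0Semigroup T ∧ (A.graph : Set (Y × Y)) = generatorGraph T

section Averages

variable {E : Type*} [NormedAddCommGroup E] [NormedSpace ℂ E]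

theorem norm_average_sub_le {p : ℕ} (hp : 0 < p) (f : ℕ → E) (a : E) (e : ℝ)
    (hf : ∀ j < p, ‖f j - a‖ ≤ e) :
    ‖(p : ℂ)⁻¹ • ∑ j ∈ Finset.range p, f j - a‖ ≤ e := by
  have hp' : (p : ℂ) ≠ 0 := by exact_mod_cast hp.ne'
  have hpr : (0 : ℝ) < p := by exact_mod_cast hp
  have h1 : (p : ℂ)⁻¹ • ∑ j ∈ Finset.range p, f j - a
      = (p : ℂ)⁻¹ • ∑ j ∈ Finset.range p, (f j - a) := by
    rw [Finset.sum_sub_distrib, smul_sub, Finset.sum_const, Finset.card_range,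
      ← Nat.cast_smul_eq_nsmul ℂ, inv_smul_smul₀ hp']
  have h2 : ‖∑ j ∈ Finset.range p, (f j - a)‖ ≤ p * e := by
    refine (norm_sum_le_of_le _ fun j hj => hf j (Finset.mem_range.1 hj)).trans ?_
    simp
  rw [h1, norm_smul, norm_inv, Complex.norm_natCast, inv_mul_le_iff₀ hpr]
  exact h2

theorem norm_pow_apply_sub_le (V : E →L[ℂ] E) {C e : ℝ} (n : ℕ) (w : ℕ → E)
    (hV : ∀ k ≤ n, ‖V ^ k‖ ≤ C) (hw : ∀ k < n, ‖V (w k) - w (k + 1)‖ ≤ e) :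
    ‖(V ^ n) (w 0) - w n‖ ≤ n * (C * e) := by
  induction n generalizing w with
  | zero => simp
  | succ n ih =>
    have h1 := ih (fun k => w (k + 1)) (fun k hk => hV k (by omega))
      (fun k hk => hw (k + 1) (by omega))
    have h0 := hw 0 (by omega)
    have h2 : ‖(V ^ n) (V (w 0) - w 1)‖ ≤ C * e :=
      (V ^ n).le_of_opNorm_le_of_le (hV n (by omega)) h0
    have h3 : (V ^ (n + 1)) (w 0) - w (n + 1)
        = (V ^ n) (V (w 0) - w 1) + ((V ^ n) (w 1) - w (n + 1)) := by
      rw [pow_succ, mul_apply_eq_comp, map_sub]; abel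
    rw [h3]
    refine (norm_add_le _ _).trans ?_
    rw [Nat.cast_succ]
    have h4 : (((n : ℕ) : ℝ) + 1) * (C * e) = C * e + n * (C * e) := by ring
    rw [h4]
    exact add_le_add h2 h1

end Averages

theorem IsCompact.exists_finite_subset_near {Y : Type*} [PseudoMetricSpace Y] {L S : Set Y}
    (hL : IsCompact L) (hLS : L ⊆ closure S) {ε : ℝ} (hε : 0 < ε) :
    ∃ F ⊆ S, F.Finite ∧ ∀ a ∈ L, ∃ b ∈ F, dist a b < ε := by
  obtain ⟨F, hFS, hF, hcov⟩ := hL.elim_finite_subcover_image (b := S)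
    (c := fun s => Metric.ball s ε) (fun _ _ => Metric.isOpen_ball) (fun a ha => by
      obtain ⟨b, hb, hab⟩ := Metric.mem_closure_iff.1 (hLS ha) ε hε
      exact Set.mem_biUnion hb hab)
  refine ⟨F, hFS, hF, fun a ha => ?_⟩
  obtain ⟨b, hb, hab⟩ := Set.mem_iUnion₂.1 (hcov ha)
  exact ⟨b, hb, hab⟩

section Semigroup

variable {X : Type*} [NormedAddCommGroup X] [NormedSpace ℂ X]

theorem IsC0Semigroup.exists_norm_le [CompleteSpace X] {U : ℝ → X →L[ℂ] X}
    (hU : IsC0Semigroup U) (T : ℝ) : ∃ C, 0 ≤ C ∧ ∀ s ∈ Set.Icc 0 T, ‖U s‖ ≤ C := by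
  obtain ⟨C, hC⟩ := banach_steinhaus (g := fun s : Set.Icc (0 : ℝ) T => U s) (fun x => by
    obtain ⟨C, hC⟩ := isCompact_Icc.exists_bound_of_continuousOn
      ((hU.2.2 x).mono (Set.Icc_subset_Ici_self : Set.Icc (0 : ℝ) T ⊆ _))
    exact ⟨C, fun s => hC s s.2⟩)
  exact ⟨max C 0, le_max_right _ _, fun s hs => (hC ⟨s, hs⟩).trans (le_max_left _ _)⟩

theorem IsC0Semigroup.map_mem_generatorGraph {U : ℝ → X →L[ℂ] X} (hU : IsC0Semigroup U)
    {p : X × X} (hp : p ∈ generatorGraph U) {s : ℝ} (hs : 0 ≤ s) :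
    (U s p.1, U s p.2) ∈ generatorGraph U := by
  have h1 := ((U s).continuous.tendsto _).comp hp
  refine h1.congr' ?_
  filter_upwards [self_mem_nhdsWithin] with h hh
  have hh : (0 : ℝ) ≤ h := le_of_lt hh
  have h2 : U s (U h p.1) = U h (U s p.1) := by
    rw [← mul_apply_eq_comp, ← hU.2.1 s h hs hh, add_comm, hU.2.1 h s hh hs,
      mul_apply_eq_comp]
  simp [h2]

theorem IsC0Semigroup.dense_domain_generator [CompleteSpace X] {U : ℝ → X →L[ℂ] X}
    (hU : IsC0Semigroup U) : Dense (Prod.fst '' generatorGraph U) := by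
  intro x
  have hint : ∀ a b : ℝ, 0 ≤ a → 0 ≤ b →
      IntervalIntegrable (fun s => U s x) MeasureTheory.volume a b := fun a b ha hb =>
    ((hU.2.2 x).mono fun s hs => le_trans (le_min ha hb) hs.1).intervalIntegrable
  have hder : ∀ d : ℝ, 0 ≤ d → Tendsto (fun h : ℝ => (h : ℂ)⁻¹ • ∫ s in d..d + h, U s x)
      (𝓝[>] 0) (𝓝 (U d x)) := by
    intro d hd
    have hc : ContinuousWithinAt (fun s => U s x) (Set.Ioi d) d :=
      ((hU.2.2 x) d hd).mono fun s hs => hd.trans (le_of_lt hs)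
    have hm : StronglyMeasurableAtFilter (fun s => U s x) (𝓝[>] d) MeasureTheory.volume :=
      ⟨Set.Ioi d, self_mem_nhdsWithin, ((hU.2.2 x).mono fun s hs =>
        hd.trans (le_of_lt hs)).aestronglyMeasurable measurableSet_Ioi⟩
    have h1 : HasDerivWithinAt (fun u => ∫ s in d..u, U s x) (U d x) (Set.Ici d) d :=
      intervalIntegral.integral_hasDerivWithinAt_right (by simp) hm hc
    have h2 := (hasDerivWithinAt_iff_tendsto_slope' (by simp)).1 h1.Ioi_of_Ici
    have h3 : Tendsto (fun h : ℝ => d + h) (𝓝[>] 0) (𝓝[>] d) := by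
      refine tendsto_nhdsWithin_iff.2 ⟨?_, ?_⟩
      · exact (Continuous.tendsto' (by fun_prop) _ _ (by simp)).mono_left nhdsWithin_le_nhds
      · filter_upwards [self_mem_nhdsWithin] with h hh
        simpa using hh
    refine (h2.comp h3).congr fun h => ?_
    simp only [Function.comp, slope, vsub_eq_sub, add_sub_cancel_left,
      intervalIntegral.integral_same, sub_zero]
    rw [← Complex.ofReal_inv, Complex.coe_smul]
  have hmem : ∀ d : ℝ, 0 < d → (d : ℂ)⁻¹ • ∫ s in (0 : ℝ)..0 + d, U s x ∈
      Prod.fst '' generatorGraph U := by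
    intro d hd
    refine ⟨(_, (d : ℂ)⁻¹ • (U d x - U 0 x)), ?_, rfl⟩
    have h1 := ((hder d hd.le).sub (hder 0 le_rfl)).const_smul ((d : ℂ)⁻¹)
    refine h1.congr' ?_
    filter_upwards [self_mem_nhdsWithin] with h hh
    have hh : 0 < h := hh
    have h2 : U h (∫ s in (0 : ℝ)..0 + d, U s x) = ∫ s in h..d + h, U s x := by
      rw [← ContinuousLinearMap.intervalIntegral_comp_comm _ (hint _ _ le_rfl (by linarith))]
      have h3 : ∫ s in (0 : ℝ)..0 + d, U h (U s x) = ∫ s in (0 : ℝ)..0 + d, U (s + h) x := by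
        refine intervalIntegral.integral_congr fun s hs => ?_
        rw [Set.uIcc_of_le (by linarith)] at hs
        rw [add_comm, hU.2.1 h s hh.le hs.1]; rfl
      rw [h3, intervalIntegral.integral_comp_add_right (fun s => U s x)]
      simp
    have h4 : (∫ s in h..d + h, U s x) - ∫ s in (0 : ℝ)..0 + d, U s x
        = (∫ s in d..d + h, U s x) - ∫ s in (0 : ℝ)..0 + h, U s x := by
      simp only [zero_add]
      have e1 := intervalIntegral.integral_add_adjacent_intervals
        (hint 0 h le_rfl hh.le) (hint h (d + h) hh.le (by linarith))
      have e2 := intervalIntegral.integral_add_adjacent_intervals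
        (hint 0 d le_rfl hd.le) (hint d (d + h) hd.le (by linarith))
      rw [sub_eq_sub_iff_add_eq_add, add_comm, e1, ← e2, add_comm]
    rw [map_smul, h2, ← smul_sub, ← smul_sub, h4, smul_comm]
  have hlim := hder 0 le_rfl
  rw [hU.1] at hlim
  refine mem_closure_of_tendsto hlim ?_
  filter_upwards [self_mem_nhdsWithin] with h hh using hmem h hh

end Semigroup

section Chernoff

variable {X : Type*} [NormedAddCommGroup X] [NormedSpace ℂ X]
  {Xm : ℕ → Type*} [∀ m, NormedAddCommGroup (Xm m)] [∀ m, NormedSpace ℂ (Xm m)]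
  {P : ∀ m, X →L[ℂ] Xm m} {K : ℝ} {V : ∀ m, ℝ → Xm m →L[ℂ] Xm m}
  {U : ℝ → X →L[ℂ] X} {S : Set (X × X)} {T C : ℝ}

/-- If the one-step consistency error vanishes on moving averages that stay close to the
orbit of a point `y` of the domain of the generator, the discrete orbit stays close to it. -/
theorem norm_pow_apply_sub_le_of_averages {E : Type*} [NormedAddCommGroup E] [NormedSpace ℂ E]
    (Q : X →L[ℂ] E) (W : E →L[ℂ] E) (hK : 0 ≤ K) (hQ : ‖Q‖ ≤ K)
    {D e h : ℝ} {n p : ℕ} (c : ℕ → X × X) (Y : ℕ → X × X)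
    (hD : 0 ≤ D) (he : 0 ≤ e) (hh : 0 < h) (hp : 0 < p) (hnT : n * h ≤ T)
    (hC : 0 ≤ C) (hW : ∀ k ≤ n, ‖W ^ k‖ ≤ C)
    (hc : ∀ k ≤ n + p, ‖W (Q (c k).1) - Q (c k).1 - (h : ℂ) • Q (c k).2‖ ≤ e * h)
    (hx : ∀ k ≤ n + p, ‖(c k).1 - (Y k).1‖ ≤ e * (2 * (p * h)))
    (hx' : ∀ k ≤ n + p, ‖(c k).1 - (Y k).1‖ ≤ e)
    (hz : ∀ k ≤ n + p, ‖(c k).2 - (Y k).2‖ ≤ e)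
    (hY1 : ∀ k ≤ n, ∀ j ≤ p, ‖(Y (k + j)).1 - (Y k).1‖ ≤ D * e)
    (hY2 : ∀ k ≤ n, ∀ j ≤ p, ‖(Y (k + j)).2 - (Y k).2‖ ≤ D * e)
    (hY3 : ∀ k ≤ n, ‖(Y (k + p)).1 - (Y k).1 - ((p * h : ℝ) : ℂ) • (Y k).2‖ ≤ D * (e * (p * h))) :
    ‖(W ^ n) (Q (Y 0).1) - Q (Y n).1‖
      ≤ (C * K * (1 + D) + T * C * (1 + K * (5 + 2 * D)) + K * (1 + D)) * e := by
  have hpr : (0 : ℝ) < p := by exact_mod_cast hp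
  have hpc : (p : ℂ) ≠ 0 := by exact_mod_cast hp.ne'
  set u : ℕ → X := fun k => (p : ℂ)⁻¹ • ∑ j ∈ Finset.range p, (c (k + j)).1 with hu
  set g : ℕ → X := fun k => (p : ℂ)⁻¹ • ∑ j ∈ Finset.range p, (c (k + j)).2 with hg
  have hT : 0 ≤ T := le_trans (by positivity) hnT
  have hua : ∀ k ≤ n, ‖u k - (Y k).1‖ ≤ (1 + D) * e := fun k hk =>
    norm_average_sub_le hp _ _ _ fun j hj => by
      have h1 := hx' (k + j) (by omega)
      have h2 := hY1 k hk j hj.le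
      refine (norm_sub_le_norm_sub_add_norm_sub _ (Y (k + j)).1 _).trans ?_
      linarith
  have hga : ∀ k ≤ n, ‖g k - (Y k).2‖ ≤ (1 + D) * e := fun k hk =>
    norm_average_sub_le hp _ _ _ fun j hj => by
      have h1 := hz (k + j) (by omega)
      have h2 := hY2 k hk j hj.le
      refine (norm_sub_le_norm_sub_add_norm_sub _ (Y (k + j)).2 _).trans ?_
      linarith
  have hcons : ∀ k ≤ n, ‖W (Q (u k)) - Q (u k) - (h : ℂ) • Q (g k)‖ ≤ e * h := fun k hk => by
    have h1 := norm_average_sub_le hp (fun j => W (Q (c (k + j)).1) - Q (c (k + j)).1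
      - (h : ℂ) • Q (c (k + j)).2) 0 (e * h) (fun j hj => by
        simpa using hc (k + j) (by omega))
    convert h1 using 2
    simp only [hu, hg, map_smul, map_sum, Finset.sum_sub_distrib, smul_sub, sub_zero,
      ← Finset.smul_sum]
    rw [smul_comm (h : ℂ)]
  have hstep : ∀ k < n, ‖u (k + 1) - u k - (h : ℂ) • (Y k).2‖ ≤ (4 + D) * e * h := by
    intro k hk
    have h1 : u (k + 1) - u k = (p : ℂ)⁻¹ • ((c (k + p)).1 - (c k).1) := by
      have h2 := Finset.sum_range_succ' (fun j => (c (k + j)).1) p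
      rw [Finset.sum_range_succ] at h2
      simp only [hu, ← smul_sub]
      congr 1
      simp only [add_zero] at h2
      have h3 : ∀ j, k + 1 + j = k + (j + 1) := fun j => by ring
      simp only [h3]
      rw [sub_eq_sub_iff_add_eq_add, ← h2, add_comm]
    have h3 : u (k + 1) - u k - (h : ℂ) • (Y k).2 = (p : ℂ)⁻¹ •
        (((c (k + p)).1 - (Y (k + p)).1) - ((c k).1 - (Y k).1)
          + ((Y (k + p)).1 - (Y k).1 - ((p * h : ℝ) : ℂ) • (Y k).2)) := by
      rw [h1]
      have : (h : ℂ) • (Y k).2 = (p : ℂ)⁻¹ • (((p * h : ℝ) : ℂ) • (Y k).2) := by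
        rw [smul_smul]; congr 1; push_cast; field_simp
      rw [this, ← smul_sub]
      congr 1
      abel
    rw [h3, norm_smul, norm_inv, Complex.norm_natCast, inv_mul_le_iff₀ hpr]
    refine (norm_add_le _ _).trans ?_
    have h4 := norm_sub_le ((c (k + p)).1 - (Y (k + p)).1) ((c k).1 - (Y k).1)
    have h5 := hx (k + p) (by omega)
    have h6 := hx k (by omega)
    have h7 := hY3 k hk.le
    linarith
  have hw : ∀ k < n, ‖W (Q (u k)) - Q (u (k + 1))‖ ≤ (1 + K * (5 + 2 * D)) * e * h := by
    intro k hk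
    have h1 : W (Q (u k)) - Q (u (k + 1)) = (W (Q (u k)) - Q (u k) - (h : ℂ) • Q (g k))
        + (Q ((h : ℂ) • (g k - (Y k).2)) - Q (u (k + 1) - u k - (h : ℂ) • (Y k).2)) := by
      simp only [map_sub, map_smul, smul_sub]
      abel
    have h2 : ‖Q ((h : ℂ) • (g k - (Y k).2))‖ ≤ K * (h * ((1 + D) * e)) := by
      refine Q.le_of_opNorm_le_of_le hQ ?_
      rw [norm_smul, Complex.norm_real, Real.norm_of_nonneg hh.le]
      exact mul_le_mul_of_nonneg_left (hga k hk.le) hh.le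
    have h3 := Q.le_of_opNorm_le_of_le hQ (hstep k hk)
    have h4 := hcons k hk.le
    rw [h1]
    refine (norm_add_le _ _).trans ?_
    refine (add_le_add h4 ((norm_sub_le _ _).trans (add_le_add h2 h3))).trans (le_of_eq ?_)
    ring
  have htel := norm_pow_apply_sub_le W n (fun k => Q (u k)) hW hw
  have hn : n * (C * ((1 + K * (5 + 2 * D)) * e * h)) ≤ T * C * (1 + K * (5 + 2 * D)) * e := by
    have : 0 ≤ C * (1 + K * (5 + 2 * D)) * e := by positivity
    nlinarith [mul_le_mul_of_nonneg_right hnT this]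
  have h0 : ‖(W ^ n) (Q ((Y 0).1 - u 0))‖ ≤ C * (K * ((1 + D) * e)) :=
    (W ^ n).le_of_opNorm_le_of_le (hW n le_rfl) (Q.le_of_opNorm_le_of_le hQ
      (by rw [norm_sub_rev]; exact hua 0 (Nat.zero_le _)))
  have hn' : ‖Q (u n - (Y n).1)‖ ≤ K * ((1 + D) * e) :=
    Q.le_of_opNorm_le_of_le hQ (hua n le_rfl)
  have hsplit : (W ^ n) (Q (Y 0).1) - Q (Y n).1 = (W ^ n) (Q ((Y 0).1 - u 0))
      + (((W ^ n) (Q (u 0)) - Q (u n)) + Q (u n - (Y n).1)) := by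
    simp only [map_sub]; abel
  rw [hsplit]
  refine (norm_add_le _ _).trans ?_
  refine (add_le_add h0 ((norm_add_le _ _).trans
    (add_le_add (htel.trans hn) hn'))).trans (le_of_eq ?_)
  ring

theorem eventually_norm_pow_apply_sub_le_of_mem_generatorGraph
    [CompleteSpace X]
    (hK : 0 ≤ K) (hP : ∀ m, ‖P m‖ ≤ K) (hU : IsC0Semigroup U)
    (hS : generatorGraph U ⊆ closure S) (hT : 0 ≤ T) (hC : 0 ≤ C)
    (hV : ∀ m, ∀ h, 0 < h → ∀ k : ℕ, k * h ≤ T → ‖V m h ^ k‖ ≤ C)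
    (hcons : ∀ p ∈ S, ∀ ε > 0, ∀ᶠ q : ℕ × ℝ in atTop ×ˢ 𝓝[>] 0,
      ‖V q.1 q.2 (P q.1 p.1) - P q.1 p.1 - (q.2 : ℂ) • P q.1 p.2‖ ≤ ε * q.2)
    {y z : X} (hy : (y, z) ∈ generatorGraph U) {η : ℝ} (hη : 0 < η) :
    ∀ᶠ q : ℕ × ℝ in atTop ×ˢ 𝓝[>] 0, ∀ n : ℕ, n * q.2 ≤ T →
      ‖(V q.1 q.2 ^ n) (P q.1 y) - P q.1 (U (n * q.2) y)‖ ≤ η := by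
  obtain ⟨D, hD, hUD⟩ := hU.exists_norm_le (T + 1)
  set Q := C * K * (1 + D) + T * C * (1 + K * (5 + 2 * D)) + K * (1 + D) with hQ
  have hQ0 : 0 ≤ Q := by positivity
  set e := η / (Q + 1) with he_def
  have he : 0 < e := by positivity
  have hQe : Q * e ≤ η := by
    rw [he_def, mul_div_assoc', div_le_iff₀ (by positivity)]
    nlinarith
  obtain ⟨δ, hδ, hδ1, hδy, hδz, hδd⟩ : ∃ δ > 0, δ ≤ 1 ∧
      (∀ s, 0 ≤ s → s ≤ δ → ‖U s y - y‖ ≤ e) ∧ (∀ s, 0 ≤ s → s ≤ δ → ‖U s z - z‖ ≤ e) ∧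
      ∀ s, 0 < s → s ≤ δ → ‖U s y - y - (s : ℂ) • z‖ ≤ e * s := by
    have hcont : ∀ x, ∃ δ > 0, ∀ s, 0 ≤ s → s ≤ δ → ‖U s x - x‖ ≤ e := fun x => by
      obtain ⟨δ, hδ, h⟩ := Metric.continuousWithinAt_iff.1
        ((hU.2.2 x) 0 Set.self_mem_Ici) e he
      refine ⟨δ / 2, by positivity, fun s hs hsδ => ?_⟩
      have h1 := h (x := s) hs (by rw [Real.dist_eq, sub_zero, abs_of_nonneg hs]; linarith)
      rw [dist_eq_norm, hU.1] at h1
      exact h1.le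
    obtain ⟨δ1, hδ1, h1⟩ := hcont y
    obtain ⟨δ2, hδ2, h2⟩ := hcont z
    have h3 : ∀ᶠ s : ℝ in 𝓝[>] 0, ‖U s y - y - (s : ℂ) • z‖ ≤ e * s := by
      filter_upwards [(Metric.tendsto_nhds.1 hy) e he, self_mem_nhdsWithin] with s hs hs0
      have hs0 : 0 < s := hs0
      have hsc : (s : ℂ) ≠ 0 := by exact_mod_cast hs0.ne'
      have h4 : U s y - y - (s : ℂ) • z = (s : ℂ) • ((s : ℂ)⁻¹ • (U s y - y) - z) := by
        rw [smul_sub, smul_inv_smul₀ hsc]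
      rw [dist_eq_norm] at hs
      rw [h4, norm_smul, Complex.norm_real, Real.norm_of_nonneg hs0.le, mul_comm]
      exact mul_le_mul_of_nonneg_right hs.le hs0.le
    obtain ⟨δ3, hδ3, h3⟩ := mem_nhdsGT_iff_exists_Ioc_subset.1 h3
    refine ⟨min (min δ1 δ2) (min δ3 1), by
      have : (0 : ℝ) < δ3 := hδ3
      positivity, (min_le_right _ _).trans (min_le_right _ _),
      fun s hs hsd => h1 s hs (hsd.trans ((min_le_left _ _).trans (min_le_left _ _))),
      fun s hs hsd => h2 s hs (hsd.trans ((min_le_left _ _).trans (min_le_right _ _))),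
      fun s hs hsd => h3 ⟨hs, hsd.trans ((min_le_right _ _).trans (min_le_left _ _))⟩⟩
  have hcpt : IsCompact ((fun s => (U s y, U s z)) '' Set.Icc 0 (T + 1)) :=
    isCompact_Icc.image_of_continuousOn (((hU.2.2 y).mono Set.Icc_subset_Ici_self).prodMk
      ((hU.2.2 z).mono Set.Icc_subset_Ici_self))
  obtain ⟨F, hFS, hF, hnear⟩ := hcpt.exists_finite_subset_near (S := S) (by
    rintro _ ⟨s, hs, rfl⟩
    exact hS (hU.map_mem_generatorGraph hy hs.1)) (show 0 < e * δ by positivity)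
  have hnear' : ∀ s : ℝ, ∃ b, s ∈ Set.Icc 0 (T + 1) →
      b ∈ F ∧ ‖b.1 - U s y‖ ≤ e * δ ∧ ‖b.2 - U s z‖ ≤ e * δ := by
    intro s
    by_cases hs : s ∈ Set.Icc 0 (T + 1)
    · obtain ⟨b, hb, hbd⟩ := hnear _ ⟨s, hs, rfl⟩
      rw [dist_comm, Prod.dist_eq, max_lt_iff, dist_eq_norm, dist_eq_norm] at hbd
      exact ⟨b, fun _ => ⟨hb, hbd.1.le, hbd.2.le⟩⟩
    · exact ⟨0, fun h => (hs h).elim⟩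
  choose c hc using hnear'
  have hFc : ∀ᶠ q : ℕ × ℝ in atTop ×ˢ 𝓝[>] 0, ∀ p ∈ F,
      ‖V q.1 q.2 (P q.1 p.1) - P q.1 p.1 - (q.2 : ℂ) • P q.1 p.2‖ ≤ e * q.2 :=
    (Set.Finite.eventually_all hF).2 fun p hp => hcons p (hFS hp) e he
  have hsmall : ∀ᶠ q : ℕ × ℝ in atTop ×ˢ 𝓝[>] 0, q.2 ∈ Set.Ioo 0 (δ / 2) :=
    tendsto_snd.eventually (Ioo_mem_nhdsGT (by positivity))
  filter_upwards [hFc, hsmall] with ⟨m, h⟩ hFm ⟨hh, hhδ⟩ n hn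
  simp only at hFm hh hhδ hn ⊢
  set p := ⌊δ / h⌋₊ with hp_def
  have hp1 : p * h ≤ δ := by
    rw [← le_div_iff₀ hh]; exact Nat.floor_le (by positivity)
  have hp2 : δ ≤ 2 * (p * h) := by
    have h1 : δ / h < p + 1 := Nat.lt_floor_add_one _
    rw [div_lt_iff₀ hh] at h1
    linarith
  have hp : 0 < p := by
    rcases Nat.eq_zero_or_pos p with h0 | h0
    · rw [h0] at hp2; simp at hp2; linarith
    · exact h0
  have hpr : (0 : ℝ) < p := by exact_mod_cast hp
  have hkT : ∀ k ≤ n, (k * h : ℝ) ∈ Set.Icc 0 (T + 1) := fun k hk => by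
    have hk' : (k : ℝ) ≤ n := by exact_mod_cast hk
    have := mul_le_mul_of_nonneg_right hk' hh.le
    exact ⟨by positivity, by linarith⟩
  have hmem : ∀ k ≤ n + p, (k * h : ℝ) ∈ Set.Icc 0 (T + 1) := fun k hk => by
    have hk' : (k : ℝ) ≤ n + p := by exact_mod_cast hk
    have := mul_le_mul_of_nonneg_right hk' hh.le
    exact ⟨by positivity, by linarith⟩
  have hjδ : ∀ j ≤ p, (j * h : ℝ) ≤ δ := fun j hj => by
    have hj' : (j : ℝ) ≤ p := by exact_mod_cast hj
    exact (mul_le_mul_of_nonneg_right hj' hh.le).trans hp1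
  have hadd : ∀ (k j : ℕ) x, U (((k + j : ℕ) : ℝ) * h) x = U (k * h) (U (j * h) x) := by
    intro k j x
    rw [Nat.cast_add, add_mul, hU.2.1 _ _ (by positivity) (by positivity)]; rfl
  have hdiff : ∀ x, (∀ s, 0 ≤ s → s ≤ δ → ‖U s x - x‖ ≤ e) → ∀ k ≤ n, ∀ j ≤ p,
      ‖U (((k + j : ℕ) : ℝ) * h) x - U (k * h) x‖ ≤ D * e := fun x hx k hk j hj => by
    rw [hadd, ← map_sub]
    exact (U _).le_of_opNorm_le_of_le (hUD _ (hkT k hk))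
      (hx _ (by positivity) (hjδ j hj))
  have key := norm_pow_apply_sub_le_of_averages (T := T) (C := C) (D := D) (e := e) (h := h)
    (n := n) (p := p) (P m) (V m h) hK (hP m)
    (fun k => c (k * h)) (fun k => (U (k * h) y, U (k * h) z)) hD he.le hh hp hn hC
    (fun k hk => hV m h hh k ((mul_le_mul_of_nonneg_right
      (by exact_mod_cast hk) hh.le).trans hn))
    (fun k hk => hFm _ (hc _ (hmem k hk)).1)
    (fun k hk => (hc _ (hmem k hk)).2.1.trans (mul_le_mul_of_nonneg_left hp2 he.le))
    (fun k hk => (hc _ (hmem k hk)).2.1.trans (mul_le_of_le_one_right he.le hδ1))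
    (fun k hk => (hc _ (hmem k hk)).2.2.trans (mul_le_of_le_one_right he.le hδ1))
    (hdiff y hδy) (hdiff z hδz)
    (fun k hk => by
      simp only
      rw [hadd, ← map_sub, ← map_smul, ← map_sub]
      exact (U _).le_of_opNorm_le_of_le (hUD _ (hkT k hk)) (hδd _ (by positivity) hp1))
  simp only [Nat.cast_zero, zero_mul, hU.1, one_apply_eq_self] at key
  exact key.trans hQe

theorem eventually_norm_pow_apply_sub_le
    [CompleteSpace X]
    (hK : 0 ≤ K) (hP : ∀ m, ‖P m‖ ≤ K) (hU : IsC0Semigroup U)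
    (hS : generatorGraph U ⊆ closure S) (hT : 0 ≤ T) (hC : 0 ≤ C)
    (hV : ∀ m, ∀ h, 0 < h → ∀ k : ℕ, k * h ≤ T → ‖V m h ^ k‖ ≤ C)
    (hcons : ∀ p ∈ S, ∀ ε > 0, ∀ᶠ q : ℕ × ℝ in atTop ×ˢ 𝓝[>] 0,
      ‖V q.1 q.2 (P q.1 p.1) - P q.1 p.1 - (q.2 : ℂ) • P q.1 p.2‖ ≤ ε * q.2)
    (x : X) {η : ℝ} (hη : 0 < η) :
    ∀ᶠ q : ℕ × ℝ in atTop ×ˢ 𝓝[>] 0, ∀ n : ℕ, n * q.2 ≤ T →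
      ‖(V q.1 q.2 ^ n) (P q.1 x) - P q.1 (U (n * q.2) x)‖ ≤ η := by
  obtain ⟨D, hD, hUD⟩ := hU.exists_norm_le T
  set L := C * K + K * D with hL
  have hL0 : 0 ≤ L := by positivity
  obtain ⟨_, ⟨⟨y, z⟩, hyz, rfl⟩, hxy⟩ := Metric.mem_closure_iff.1
    (hU.dense_domain_generator x) (η / 2 / (L + 1)) (by positivity)
  rw [dist_eq_norm, lt_div_iff₀ (by positivity)] at hxy
  have hsmall : ∀ᶠ q : ℕ × ℝ in atTop ×ˢ 𝓝[>] 0, 0 < q.2 :=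
    tendsto_snd.eventually (self_mem_nhdsWithin)
  filter_upwards [hsmall, eventually_norm_pow_apply_sub_le_of_mem_generatorGraph hK hP hU hS hT hC
    hV hcons hyz (half_pos hη)] with ⟨m, h⟩ hh hm n hn
  simp only at hh hm hn hxy ⊢
  have h1 : ‖(V m h ^ n) (P m (x - y))‖ ≤ C * (K * ‖x - y‖) :=
    (V m h ^ n).le_of_opNorm_le_of_le (hV m h hh n hn) ((P m).le_of_opNorm_le (hP m) _)
  have h2 : ‖P m (U (n * h) (x - y))‖ ≤ K * (D * ‖x - y‖) :=
    (P m).le_of_opNorm_le_of_le (hP m)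
      ((U _).le_of_opNorm_le (hUD _ ⟨by positivity, hn⟩) _)
  have h3 : (V m h ^ n) (P m x) - P m (U (n * h) x) = (V m h ^ n) (P m (x - y))
      - P m (U (n * h) (x - y)) + ((V m h ^ n) (P m y) - P m (U (n * h) y)) := by
    simp only [map_sub]; abel
  rw [h3]
  refine (norm_add_le _ _).trans ?_
  have h4 := norm_sub_le ((V m h ^ n) (P m (x - y))) (P m (U (n * h) (x - y)))
  have h5 := hm n hn
  have h6 := norm_nonneg (x - y)
  nlinarith

/-- A bounded sequence of operators that converges strongly to the identity converges
uniformly on compact sets. -/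
theorem eventually_norm_apply_sub_le_of_isCompact {Q : ℕ → X →L[ℂ] X}
    (hK : 0 ≤ K) (hQ : ∀ m, ‖Q m‖ ≤ K) (hlim : ∀ x, Tendsto (fun m => Q m x) atTop (𝓝 x))
    {L : Set X} (hL : IsCompact L) {η : ℝ} (hη : 0 < η) :
    ∀ᶠ m in atTop, ∀ x ∈ L, ‖Q m x - x‖ ≤ η := by
  obtain ⟨F, -, hF, hnear⟩ := hL.exists_finite_subset_near subset_closure
    (show 0 < η / 2 / (K + 1) by positivity)
  have hFe : ∀ᶠ m in atTop, ∀ x ∈ F, ‖Q m x - x‖ < η / 2 :=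
    (Set.Finite.eventually_all hF).2 fun x _ => by
      simpa [dist_eq_norm] using Metric.tendsto_nhds.1 (hlim x) (η / 2) (half_pos hη)
  filter_upwards [hFe] with m hm x hx
  obtain ⟨b, hb, hxb⟩ := hnear x hx
  rw [dist_eq_norm, lt_div_iff₀ (by positivity)] at hxb
  have h1 : Q m x - x = Q m (x - b) - (x - b) + (Q m b - b) := by
    simp only [map_sub]; abel
  have h2 := (Q m).le_of_opNorm_le (hQ m) (x - b)
  have h3 := hm b hb
  rw [h1]
  refine (norm_add_le _ _).trans ?_
  have h4 := norm_sub_le (Q m (x - b)) (x - b)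
  linarith

end Chernoff

section Consistency

variable {X : Type*} [NormedAddCommGroup X] [NormedSpace ℂ X]
  {Xm : ℕ → Type*} [∀ m, NormedAddCommGroup (Xm m)] [∀ m, NormedSpace ℂ (Xm m)]
  {P : ∀ m, X →L[ℂ] Xm m} {J : ∀ m, Xm m →L[ℂ] X} {K M : ℝ}

/-- The family `v`, indexed by the spatial parameter `m` and the step size `h`, converges to
`x` in the sense of discrete convergence: `‖v (m, h) - P m x‖ → 0` as `m → ∞`, `h → 0+`. -/
def DiscreteTendsto (P : ∀ m, X →L[ℂ] Xm m) (v : ∀ q : ℕ × ℝ, Xm q.1) (x : X) : Prop :=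
  Tendsto (fun q : ℕ × ℝ => ‖v q - P q.1 x‖) (atTop ×ˢ 𝓝[>] 0) (𝓝 0)

theorem eventually_snd_pos : ∀ᶠ q : ℕ × ℝ in atTop ×ˢ 𝓝[>] 0, 0 < q.2 :=
  tendsto_snd.eventually self_mem_nhdsWithin

namespace DiscreteTendsto

variable {v w : ∀ q : ℕ × ℝ, Xm q.1} {x y : X}

theorem congr' (hv : DiscreteTendsto P v x)
    (h : ∀ᶠ q : ℕ × ℝ in atTop ×ˢ 𝓝[>] 0, v q = w q) : DiscreteTendsto P w x :=
  Tendsto.congr' (h.mono fun q hq => by rw [hq]) hv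

theorem add (hv : DiscreteTendsto P v x) (hw : DiscreteTendsto P w y) :
    DiscreteTendsto P (fun q => v q + w q) (x + y) := by
  have h := Tendsto.add hv hw
  rw [add_zero] at h
  refine squeeze_zero (fun _ => norm_nonneg _) (fun q => ?_) h
  rw [map_add, add_sub_add_comm]
  exact norm_add_le _ _

theorem const_smul (c : ℂ) (hv : DiscreteTendsto P v x) :
    DiscreteTendsto P (fun q => c • v q) (c • x) := by
  have h := Tendsto.const_mul ‖c‖ hv
  rw [mul_zero] at h
  refine Tendsto.congr (fun q => ?_) h
  rw [map_smul, ← smul_sub, norm_smul]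

theorem sum {ι : Type*} (s : Finset ι) {f : ι → ∀ q : ℕ × ℝ, Xm q.1} {g : ι → X}
    (h : ∀ i ∈ s, DiscreteTendsto P (f i) (g i)) :
    DiscreteTendsto P (fun q => ∑ i ∈ s, f i q) (∑ i ∈ s, g i) := by
  classical
  induction s using Finset.induction_on with
  | empty => simp [DiscreteTendsto]
  | insert a s ha ih =>
    simp only [Finset.sum_insert ha]
    exact (h a (Finset.mem_insert_self _ _)).add
      (ih fun i hi => h i (Finset.mem_insert_of_mem hi))

theorem map_of_norm_le {W : ∀ q : ℕ × ℝ, Xm q.1 →L[ℂ] Xm q.1} {C : ℝ}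
    (hW : ∀ᶠ q : ℕ × ℝ in atTop ×ˢ 𝓝[>] 0, ‖W q‖ ≤ C)
    (hWx : DiscreteTendsto P (fun q => W q (P q.1 x)) x) (hv : DiscreteTendsto P v x) :
    DiscreteTendsto P (fun q => W q (v q)) x := by
  have h := (Tendsto.const_mul C hv).add hWx
  rw [mul_zero, add_zero] at h
  refine squeeze_zero' (.of_forall fun _ => norm_nonneg _) ?_ h
  filter_upwards [hW] with q hq
  have h1 : W q (v q) - P q.1 x = W q (v q - P q.1 x) + (W q (P q.1 x) - P q.1 x) := by
    rw [map_sub]; abel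
  rw [h1]
  exact (norm_add_le _ _).trans (add_le_add ((W q).le_of_opNorm_le hq _) le_rfl)

theorem eventually_norm_le (hP : ∀ m, ‖P m‖ ≤ K) (hv : DiscreteTendsto P v x) :
    ∀ᶠ q : ℕ × ℝ in atTop ×ˢ 𝓝[>] 0, ‖v q‖ ≤ K * ‖x‖ + 1 := by
  filter_upwards [Tendsto.eventually_lt_const one_pos hv] with q hq
  have h1 := norm_le_norm_add_norm_sub' (v q) (P q.1 x)
  have h2 := (P q.1).le_of_opNorm_le (hP _) x
  linarith

/-- A uniformly bounded family of operators that converges on a dense set to the identity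
converges to the identity everywhere. -/
theorem of_dense (hK : 0 ≤ K) (hP : ∀ m, ‖P m‖ ≤ K)
    {W : ∀ q : ℕ × ℝ, Xm q.1 →L[ℂ] Xm q.1} {C : ℝ} (hC : 0 ≤ C)
    (hW : ∀ᶠ q : ℕ × ℝ in atTop ×ˢ 𝓝[>] 0, ‖W q‖ ≤ C) {D : Set X} (hD : Dense D)
    (h : ∀ x ∈ D, DiscreteTendsto P (fun q => W q (P q.1 x)) x) (x : X) :
    DiscreteTendsto P (fun q => W q (P q.1 x)) x := by
  refine Metric.tendsto_nhds.2 fun ε hε => ?_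
  obtain ⟨y, hy, hxy⟩ := Metric.mem_closure_iff.1 (hD x) (ε / 2 / (C * K + K + 1))
    (by positivity)
  rw [dist_eq_norm, lt_div_iff₀ (by positivity)] at hxy
  filter_upwards [hW, Tendsto.eventually_lt_const (half_pos hε) (h y hy)] with q hq hqy
  rw [dist_zero_right, norm_norm]
  have h1 : W q (P q.1 x) - P q.1 x = W q (P q.1 (x - y)) - P q.1 (x - y)
      + (W q (P q.1 y) - P q.1 y) := by
    simp only [map_sub]; abel
  have h2 := (P q.1).le_of_opNorm_le (hP _) (x - y)
  have h3 := (W q).le_of_opNorm_le_of_le hq h2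
  have h4 := norm_sub_le (W q (P q.1 (x - y))) (P q.1 (x - y))
  have h5 := norm_nonneg (x - y)
  rw [h1]
  refine (norm_add_le _ _).trans_lt ?_
  nlinarith

end DiscreteTendsto

section Resolvent

variable {A : X →ₗ.[ℂ] X} {Am : ∀ m, Xm m →ₗ.[ℂ] Xm m} {R : ∀ m, ℂ → Xm m →L[ℂ] Xm m}

theorem re_div_ofReal_pos {lam : ℂ} (hlam : 0 < lam.re) {h : ℝ} (hh : 0 < h) :
    0 < (lam / (h : ℂ)).re := by
  rw [Complex.div_ofReal_re]; positivity

theorem eventually_norm_smul_resolvent_le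
    (hR : ∀ m, ∀ lam : ℂ, 0 < lam.re → IsResolvent (Am m) lam (R m lam) ∧ lam.re * ‖R m lam‖ ≤ M)
    {lam : ℂ} (hlam : 0 < lam.re) :
    ∀ᶠ q : ℕ × ℝ in atTop ×ˢ 𝓝[>] 0,
      ‖(lam / (q.2 : ℂ)) • R q.1 (lam / (q.2 : ℂ))‖ ≤ ‖lam‖ / lam.re * M := by
  filter_upwards [eventually_snd_pos] with q hq
  have h1 := (hR q.1 _ (re_div_ofReal_pos hlam hq)).2
  rw [Complex.div_ofReal_re] at h1
  rw [norm_smul, norm_div, Complex.norm_real, Real.norm_of_nonneg hq.le]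
  calc ‖lam‖ / q.2 * ‖R q.1 (lam / (q.2 : ℂ))‖
      = ‖lam‖ / lam.re * (lam.re / q.2 * ‖R q.1 (lam / (q.2 : ℂ))‖) := by field_simp
    _ ≤ _ := mul_le_mul_of_nonneg_left h1 (by positivity)

theorem smul_resolvent_apply_sub {Y : Type*} [NormedAddCommGroup Y] [NormedSpace ℂ Y]
    {G : Y →ₗ.[ℂ] Y} {lam : ℂ} {h : ℝ} (hlam : lam ≠ 0) (hh : 0 < h) {Q : Y →L[ℂ] Y}
    (hQ : IsResolvent G (lam / (h : ℂ)) Q) (y : G.domain) :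
    ((lam / (h : ℂ)) • Q) (y : Y) - y = ((h : ℂ) / lam) • ((lam / (h : ℂ)) • Q) (G y) := by
  have hh' : (h : ℂ) ≠ 0 := by exact_mod_cast hh.ne'
  have h1 := hQ.eq_left y
  rw [map_sub, map_smul, sub_eq_iff_eq_add] at h1
  rw [smul_apply, smul_apply, smul_smul, h1, add_sub_cancel_left, div_mul_div_cancel₀ hlam,
    div_self hh', one_smul]

theorem discreteTendsto_apply_proj (hP : ∀ m, ‖P m‖ ≤ K) (hPJ : ∀ m (y : Xm m), P m (J m y) = y)
    (hdom : ∀ m, ∀ x ∈ A.domain, P m x ∈ (Am m).domain)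
    (hcons : ∀ x : A.domain,
      Tendsto (fun m => J m ((Am m) ⟨P m (x : X), hdom m x x.2⟩)) atTop (𝓝 (A x)))
    (x : A.domain) :
    DiscreteTendsto P (fun q => Am q.1 ⟨P q.1 (x : X), hdom q.1 x x.2⟩) (A x) := by
  have h1 := (tendsto_iff_norm_sub_tendsto_zero.1 (hcons x)).const_mul K
  rw [mul_zero] at h1
  refine squeeze_zero (fun _ => norm_nonneg _) (fun q => ?_)
    (h1.comp (tendsto_fst (f := atTop) (g := 𝓝[>] (0 : ℝ))))
  have h2 := (P q.1).le_of_opNorm_le (hP _)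
    (J q.1 (Am q.1 ⟨P q.1 (x : X), hdom q.1 x x.2⟩) - A x)
  rwa [map_sub, hPJ] at h2

theorem discreteTendsto_smul_resolvent (hK : 0 ≤ K) (hP : ∀ m, ‖P m‖ ≤ K)
    (hPJ : ∀ m (y : Xm m), P m (J m y) = y) (hdense : Dense (A.domain : Set X))
    (hdom : ∀ m, ∀ x ∈ A.domain, P m x ∈ (Am m).domain)
    (hcons : ∀ x : A.domain,
      Tendsto (fun m => J m ((Am m) ⟨P m (x : X), hdom m x x.2⟩)) atTop (𝓝 (A x)))
    (hM : 0 ≤ M)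
    (hR : ∀ m, ∀ lam : ℂ, 0 < lam.re → IsResolvent (Am m) lam (R m lam) ∧ lam.re * ‖R m lam‖ ≤ M)
    {lam : ℂ} (hlam : 0 < lam.re) {v : ∀ q : ℕ × ℝ, Xm q.1} {x : X}
    (hv : DiscreteTendsto P v x) :
    DiscreteTendsto P (fun q => ((lam / (q.2 : ℂ)) • R q.1 (lam / (q.2 : ℂ))) (v q)) x := by
  have hb := eventually_norm_smul_resolvent_le hR hlam
  refine DiscreteTendsto.map_of_norm_le hb (DiscreteTendsto.of_dense hK hP (by positivity) hb
    hdense (fun x hx => ?_) x) hv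
  have hlim := (discreteTendsto_apply_proj hP hPJ hdom hcons ⟨x, hx⟩).eventually_norm_le hP
  have hne : lam ≠ 0 := fun h => by simp [h] at hlam
  have hh : Tendsto (fun q : ℕ × ℝ => q.2 / ‖lam‖ *
      (‖lam‖ / lam.re * M * (K * ‖A ⟨x, hx⟩‖ + 1))) (atTop ×ˢ 𝓝[>] 0) (𝓝 0) := by
    have h1 : Tendsto (fun q : ℕ × ℝ => q.2) (atTop ×ˢ 𝓝[>] 0) (𝓝 0) :=
      (tendsto_id.mono_left nhdsWithin_le_nhds).comp tendsto_snd
    simpa using (h1.div_const ‖lam‖).mul_const (‖lam‖ / lam.re * M * (K * ‖A ⟨x, hx⟩‖ + 1))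
  refine squeeze_zero' (.of_forall fun _ => norm_nonneg _) ?_ hh
  filter_upwards [hb, hlim, eventually_snd_pos] with q hq hql hq0
  rw [smul_resolvent_apply_sub hne hq0 (hR q.1 _ (re_div_ofReal_pos hlam hq0)).1
    ⟨P q.1 x, hdom q.1 x hx⟩, norm_smul, norm_div, Complex.norm_real, Real.norm_of_nonneg hq0.le]
  exact mul_le_mul_of_nonneg_left (ContinuousLinearMap.le_of_opNorm_le_of_le _ hq hql)
    (by positivity)

theorem discreteTendsto_smul_resolvent_pow (hK : 0 ≤ K) (hP : ∀ m, ‖P m‖ ≤ K)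
    (hPJ : ∀ m (y : Xm m), P m (J m y) = y) (hdense : Dense (A.domain : Set X))
    (hdom : ∀ m, ∀ x ∈ A.domain, P m x ∈ (Am m).domain)
    (hcons : ∀ x : A.domain,
      Tendsto (fun m => J m ((Am m) ⟨P m (x : X), hdom m x x.2⟩)) atTop (𝓝 (A x)))
    (hM : 0 ≤ M)
    (hR : ∀ m, ∀ lam : ℂ, 0 < lam.re → IsResolvent (Am m) lam (R m lam) ∧ lam.re * ‖R m lam‖ ≤ M)
    {lam : ℂ} (hlam : 0 < lam.re) {v : ∀ q : ℕ × ℝ, Xm q.1} {x : X}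
    (hv : DiscreteTendsto P v x) (j : ℕ) :
    DiscreteTendsto P
      (fun q => (((lam / (q.2 : ℂ)) • R q.1 (lam / (q.2 : ℂ))) ^ j) (v q)) x := by
  induction j with
  | zero => exact hv
  | succ j ih =>
    refine DiscreteTendsto.congr' ?_ (.of_forall fun q => by rw [pow_succ', mul_apply_eq_comp])
    exact discreteTendsto_smul_resolvent hK hP hPJ hdense hdom hcons hM hR hlam ih

variable {l : ℕ} {ν : Fin l → ℕ} {lam : Fin l → ℂ} {c : Fin l → ℕ → ℂ}

theorem sum_coeff_eq_one (h0 : pfdFun l ν lam c 0 = 1) :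
    ∑ i, ∑ j ∈ Finset.Icc 1 (ν i), c i j = 1 := by
  simpa [pfdFun] using h0

theorem sum_coeff_mul_div_eq_one (h1 : HasDerivAt (pfdFun l ν lam c) 1 0) :
    ∑ i, ∑ j ∈ Finset.Icc 1 (ν i), c i j * (j / lam i) = 1 := by
  have h2 : HasDerivAt (pfdFun l ν lam c)
      (∑ i, ∑ j ∈ Finset.Icc 1 (ν i), c i j * (j / lam i)) 0 := by
    refine HasDerivAt.fun_sum fun i _ => HasDerivAt.fun_sum fun j _ => ?_
    have h3 : HasDerivAt (fun z : ℂ => 1 - z / lam i) (-(1 / lam i)) 0 :=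
      ((hasDerivAt_id (0 : ℂ)).div_const (lam i)).const_sub 1
    have h4 := ((hasDerivAt_zpow (-(j : ℤ)) (1 - 0 / lam i) (Or.inl (by simp))).comp 0 h3).const_mul
      (c i j)
    refine h4.congr_deriv ?_
    simp [div_eq_mul_inv]
  exact h2.unique h1

theorem discreteTendsto_ratOp (hK : 0 ≤ K) (hP : ∀ m, ‖P m‖ ≤ K)
    (hPJ : ∀ m (y : Xm m), P m (J m y) = y) (hdense : Dense (A.domain : Set X))
    (hdom : ∀ m, ∀ x ∈ A.domain, P m x ∈ (Am m).domain)
    (hcons : ∀ x : A.domain,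
      Tendsto (fun m => J m ((Am m) ⟨P m (x : X), hdom m x x.2⟩)) atTop (𝓝 (A x)))
    (hM : 0 ≤ M)
    (hR : ∀ m, ∀ lam : ℂ, 0 < lam.re → IsResolvent (Am m) lam (R m lam) ∧ lam.re * ‖R m lam‖ ≤ M)
    (hlam : ∀ i, 0 < (lam i).re) (h0 : pfdFun l ν lam c 0 = 1)
    {v : ∀ q : ℕ × ℝ, Xm q.1} {x : X} (hv : DiscreteTendsto P v x) :
    DiscreteTendsto P (fun q => ratOp l ν lam c (R q.1) q.2 (v q)) x := by
  have h := DiscreteTendsto.sum Finset.univ fun i _ =>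
    DiscreteTendsto.sum (Finset.Icc 1 (ν i)) fun j _ =>
      (discreteTendsto_smul_resolvent_pow hK hP hPJ hdense hdom hcons hM hR (hlam i) hv j).const_smul
        (c i j)
  simp only [← Finset.sum_smul, sum_coeff_eq_one h0, one_smul] at h
  refine h.congr' ?_
  filter_upwards [eventually_snd_pos] with q hq
  simp [ratOp, hq.not_ge, sum_apply]

theorem discreteTendsto_ratOp_sub (hK : 0 ≤ K) (hP : ∀ m, ‖P m‖ ≤ K)
    (hPJ : ∀ m (y : Xm m), P m (J m y) = y) (hdense : Dense (A.domain : Set X))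
    (hdom : ∀ m, ∀ x ∈ A.domain, P m x ∈ (Am m).domain)
    (hcons : ∀ x : A.domain,
      Tendsto (fun m => J m ((Am m) ⟨P m (x : X), hdom m x x.2⟩)) atTop (𝓝 (A x)))
    (hM : 0 ≤ M)
    (hR : ∀ m, ∀ lam : ℂ, 0 < lam.re → IsResolvent (Am m) lam (R m lam) ∧ lam.re * ‖R m lam‖ ≤ M)
    (hlam : ∀ i, 0 < (lam i).re) (h0 : pfdFun l ν lam c 0 = 1)
    (h1 : HasDerivAt (pfdFun l ν lam c) 1 0) (x : A.domain) :
    DiscreteTendsto P (fun q => (q.2 : ℂ)⁻¹ •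
      (ratOp l ν lam c (R q.1) q.2 (P q.1 x) - P q.1 x)) (A x) := by
  have hA := discreteTendsto_apply_proj hP hPJ hdom hcons x
  have h := DiscreteTendsto.sum Finset.univ fun i _ =>
    DiscreteTendsto.sum (Finset.Icc 1 (ν i)) fun j _ =>
      (((DiscreteTendsto.sum (Finset.range j) fun k _ => discreteTendsto_smul_resolvent_pow hK hP hPJ
        hdense hdom hcons hM hR (hlam i) hA (k + 1)).const_smul (lam i)⁻¹).const_smul (c i j))
  have hlim : ∑ i, ∑ j ∈ Finset.Icc 1 (ν i), c i j • (lam i)⁻¹ • ∑ k ∈ Finset.range j, A x = A x := by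
    have h2 : ∀ i, ∀ j : ℕ, c i j • (lam i)⁻¹ • ∑ k ∈ Finset.range j, A x
        = (c i j * (j / lam i)) • A x := fun i j => by
      rw [Finset.sum_const, Finset.card_range, ← Nat.cast_smul_eq_nsmul ℂ, smul_smul, smul_smul]
      congr 1
      ring
    simp only [h2, ← Finset.sum_smul, sum_coeff_mul_div_eq_one h1, one_smul]
  rw [hlim] at h
  refine h.congr' ?_
  filter_upwards [eventually_snd_pos] with q hq
  have hq' : (q.2 : ℂ) ≠ 0 := by exact_mod_cast hq.ne'
  have hpow : ∀ i, ∀ j : ℕ,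
      (lam i)⁻¹ • ∑ k ∈ Finset.range j, (((lam i / (q.2 : ℂ)) • R q.1 (lam i / (q.2 : ℂ))) ^ (k + 1))
        (Am q.1 ⟨P q.1 (x : X), hdom q.1 x x.2⟩) =
      (q.2 : ℂ)⁻¹ • ((((lam i / (q.2 : ℂ)) • R q.1 (lam i / (q.2 : ℂ))) ^ j) (P q.1 x) - P q.1 x) := by
    intro i j
    have hne : lam i ≠ 0 := fun h => by simpa [h] using hlam i
    have hS := smul_resolvent_apply_sub hne hq (hR q.1 _ (re_div_ofReal_pos (hlam i) hq)).1
      ⟨P q.1 x, hdom q.1 x x.2⟩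
    induction j with
    | zero => simp
    | succ j ih =>
      rw [Finset.sum_range_succ, smul_add, ih, pow_succ, mul_apply_eq_comp, mul_apply_eq_comp]
      rw [sub_eq_iff_eq_add] at hS
      simp only at hS
      rw [hS, map_add, map_smul, add_sub_assoc, smul_add, smul_smul, add_comm, inv_mul_eq_div,
        div_div_cancel_left' hq']
  simp only [hpow]
  simp only [smul_sub, Finset.sum_sub_distrib, ← Finset.sum_smul, ← smul_comm (q.2 : ℂ)⁻¹,
    ← Finset.smul_sum, sum_coeff_eq_one h0, one_smul]
  simp [ratOp, hq.not_ge, sum_apply]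

end Resolvent

end Consistency

/-- **Convergence of the sequential splitting with spatial and rational temporal
discretization.** Under the stability bound `‖[q(h B m) r(h A m)]^k‖ ≤ M₁ e^{khω}`,
`J m [q((t/n) B m) r((t/n) A m)]^n P m x → U(t) x` as `m, n → ∞`, uniformly for `t`
in compact intervals of `[0, ∞)`. -/
theorem sequential_splitting_convergence
    (X : Type*) [NormedAddCommGroup X] [NormedSpace ℂ X] [CompleteSpace X]
    (Xm : ℕ → Type*) [∀ m, NormedAddCommGroup (Xm m)] [∀ m, NormedSpace ℂ (Xm m)]
    [∀ m, CompleteSpace (Xm m)]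
    -- the approximation scheme
    (P : ∀ m, X →L[ℂ] Xm m) (J : ∀ m, Xm m →L[ℂ] X)
    (hPJ : ∀ m (y : Xm m), P m (J m y) = y)
    (hJP : ∀ x : X, Tendsto (fun m => J m (P m x)) atTop (𝓝 x))
    (K : ℝ) (hK : 0 < K) (hJnorm : ∀ m, ‖J m‖ ≤ K) (hPnorm : ∀ m, ‖P m‖ ≤ K)
    -- the operators `A, A m`: closed and densely defined
    (A : X →ₗ.[ℂ] X) (hAclosed : IsClosed (A.graph : Set (X × X)))
    (hAdense : Dense (A.domain : Set X))
    (Am : ∀ m, Xm m →ₗ.[ℂ] Xm m)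
    (hAmclosed : ∀ m, IsClosed ((Am m).graph : Set (Xm m × Xm m)))
    (hAmdense : ∀ m, Dense ((Am m).domain : Set (Xm m)))
    -- stability of the family `A, A m`
    (RA : ℂ → X →L[ℂ] X) (RAm : ∀ m, ℂ → Xm m →L[ℂ] Xm m) (MA : ℝ) (hMA : 0 ≤ MA)
    (hRA : ∀ lam : ℂ, 0 < lam.re → IsResolvent A lam (RA lam) ∧ lam.re * ‖RA lam‖ ≤ MA)
    (hRAm : ∀ m, ∀ lam : ℂ, 0 < lam.re →
      IsResolvent (Am m) lam (RAm m lam) ∧ lam.re * ‖RAm m lam‖ ≤ MA)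
    -- consistency of the family `A, A m`
    (hPdomA : ∀ m, ∀ x ∈ A.domain, P m x ∈ (Am m).domain)
    (hconsA : ∀ x : A.domain,
      Tendsto (fun m => J m ((Am m) ⟨P m (x : X), hPdomA m x x.2⟩)) atTop (𝓝 (A x)))
    -- the operators `B, B m`: closed and densely defined
    (B : X →ₗ.[ℂ] X) (hBclosed : IsClosed (B.graph : Set (X × X)))
    (hBdense : Dense (B.domain : Set X))
    (Bm : ∀ m, Xm m →ₗ.[ℂ] Xm m)
    (hBmclosed : ∀ m, IsClosed ((Bm m).graph : Set (Xm m × Xm m)))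
    (hBmdense : ∀ m, Dense ((Bm m).domain : Set (Xm m)))
    -- stability of the family `B, B m`
    (RB : ℂ → X →L[ℂ] X) (RBm : ∀ m, ℂ → Xm m →L[ℂ] Xm m) (MB : ℝ) (hMB : 0 ≤ MB)
    (hRB : ∀ lam : ℂ, 0 < lam.re → IsResolvent B lam (RB lam) ∧ lam.re * ‖RB lam‖ ≤ MB)
    (hRBm : ∀ m, ∀ lam : ℂ, 0 < lam.re →
      IsResolvent (Bm m) lam (RBm m lam) ∧ lam.re * ‖RBm m lam‖ ≤ MB)
    -- consistency of the family `B, B m`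
    (hPdomB : ∀ m, ∀ x ∈ B.domain, P m x ∈ (Bm m).domain)
    (hconsB : ∀ x : B.domain,
      Tendsto (fun m => J m ((Bm m) ⟨P m (x : X), hPdomB m x x.2⟩)) atTop (𝓝 (B x)))
    -- the rational function `r`, via its partial fraction decomposition
    (lr : ℕ) (νr : Fin lr → ℕ) (hνr : ∀ i, 1 ≤ νr i) (lamr : Fin lr → ℂ)
    (Cr : Fin lr → ℕ → ℂ) (hlamr : ∀ i, 0 < (lamr i).re)
    (hr0 : pfdFun lr νr lamr Cr 0 = 1)
    (hr1 : HasDerivAt (pfdFun lr νr lamr Cr) 1 0)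
    (hrbdd : ∃ Cb : ℝ, ∀ z : ℂ, z.re ≤ 0 → ‖pfdFun lr νr lamr Cr z‖ ≤ Cb)
    -- the rational function `q`, via its partial fraction decomposition
    (lq : ℕ) (νq : Fin lq → ℕ) (hνq : ∀ i, 1 ≤ νq i) (lamq : Fin lq → ℂ)
    (Cq : Fin lq → ℕ → ℂ) (hlamq : ∀ i, 0 < (lamq i).re)
    (hq0 : pfdFun lq νq lamq Cq 0 = 1)
    (hq1 : HasDerivAt (pfdFun lq νq lamq Cq) 1 0)
    (hqbdd : ∃ Cb : ℝ, ∀ z : ℂ, z.re ≤ 0 → ‖pfdFun lq νq lamq Cq z‖ ≤ Cb)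
    -- `A` and `B` generate strongly continuous semigroups on `X`
    (TA : ℝ → X →L[ℂ] X) (hTA : IsGenerator A TA)
    (TB : ℝ → X →L[ℂ] X) (hTB : IsGenerator B TB)
    -- the closure of `A + B` (defined on `D(A) ∩ D(B)`) generates the semigroup `U`
    (U : ℝ → X →L[ℂ] X) (hU : IsC0Semigroup U)
    (hgen : closure {p : X × X | ∃ (hA : p.1 ∈ A.domain) (hB : p.1 ∈ B.domain),
        A ⟨p.1, hA⟩ + B ⟨p.1, hB⟩ = p.2} = generatorGraph U)
    -- the stability bound
    (M₁ : ℝ) (hM₁ : 1 ≤ M₁) (ω : ℝ)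
    (hstab : ∀ h : ℝ, 0 < h → ∀ k m : ℕ,
      ‖(ratOp lq νq lamq Cq (RBm m) h * ratOp lr νr lamr Cr (RAm m) h) ^ k‖
        ≤ M₁ * Real.exp (k * h * ω))
 :
    ∀ x : X, ∀ t₀ : ℝ, 0 ≤ t₀ → ∀ ε > (0 : ℝ), ∃ N : ℕ, ∀ m ≥ N, ∀ n ≥ N,
      ∀ t : ℝ, 0 ≤ t → t ≤ t₀ →
        ‖J m (((ratOp lq νq lamq Cq (RBm m) (t / n)
            * ratOp lr νr lamr Cr (RAm m) (t / n)) ^ n) (P m x)) - U t x‖ ≤ ε := by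

  intro x t₀ ht₀ ε hε
  set V : ∀ m, ℝ → Xm m →L[ℂ] Xm m := fun m h =>
    ratOp lq νq lamq Cq (RBm m) h * ratOp lr νr lamr Cr (RAm m) h with hVdef
  set S : Set (X × X) := {p : X × X | ∃ (hA : p.1 ∈ A.domain) (hB : p.1 ∈ B.domain),
    A ⟨p.1, hA⟩ + B ⟨p.1, hB⟩ = p.2} with hS
  have hcons : ∀ p ∈ S, ∀ ε > 0, ∀ᶠ q : ℕ × ℝ in atTop ×ˢ 𝓝[>] 0,
      ‖V q.1 q.2 (P q.1 p.1) - P q.1 p.1 - (q.2 : ℂ) • P q.1 p.2‖ ≤ ε * q.2 := by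
    rintro ⟨y, w⟩ ⟨(hA : y ∈ A.domain), (hB : y ∈ B.domain),
      (hw : A ⟨y, hA⟩ + B ⟨y, hB⟩ = w)⟩ e he
    subst hw
    have h1 := discreteTendsto_ratOp hK.le hPnorm hPJ hBdense hPdomB hconsB hMB hRBm hlamq hq0
      (discreteTendsto_ratOp_sub hK.le hPnorm hPJ hAdense hPdomA hconsA hMA hRAm hlamr hr0 hr1
        ⟨y, hA⟩)
    have h2 := discreteTendsto_ratOp_sub hK.le hPnorm hPJ hBdense hPdomB hconsB hMB hRBm hlamq
      hq0 hq1 ⟨y, hB⟩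
    filter_upwards [eventually_snd_pos, Tendsto.eventually_lt_const he (h1.add h2)] with q hq hqe
    have hqc : (q.2 : ℂ) ≠ 0 := by exact_mod_cast hq.ne'
    have h3 : V q.1 q.2 (P q.1 y) - P q.1 y - (q.2 : ℂ) • P q.1 (A ⟨y, hA⟩ + B ⟨y, hB⟩)
        = (q.2 : ℂ) • (ratOp lq νq lamq Cq (RBm q.1) q.2 ((q.2 : ℂ)⁻¹ •
            (ratOp lr νr lamr Cr (RAm q.1) q.2 (P q.1 y) - P q.1 y))
          + (q.2 : ℂ)⁻¹ • (ratOp lq νq lamq Cq (RBm q.1) q.2 (P q.1 y) - P q.1 y)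
          - P q.1 (A ⟨y, hA⟩ + B ⟨y, hB⟩)) := by
      rw [map_smul, ← smul_add, smul_sub (q.2 : ℂ), smul_inv_smul₀ hqc, map_sub, hVdef]
      simp only [mul_apply_eq_comp, sub_add_sub_cancel]
    rw [h3, norm_smul, Complex.norm_real, Real.norm_of_nonneg hq.le, mul_comm]
    exact mul_le_mul_of_nonneg_right hqe.le hq.le
  have hV : ∀ m, ∀ h, 0 < h → ∀ k : ℕ, k * h ≤ t₀ →
      ‖V m h ^ k‖ ≤ M₁ * Real.exp (t₀ * |ω|) := by
    intro m h hh k hk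
    refine (hstab h hh k m).trans (mul_le_mul_of_nonneg_left (Real.exp_le_exp.2 ?_) (by linarith))
    exact (mul_le_mul_of_nonneg_left (le_abs_self ω) (by positivity)).trans
      (mul_le_mul_of_nonneg_right hk (abs_nonneg _))
  have hmain := eventually_norm_pow_apply_sub_le hK.le hPnorm hU hgen.ge ht₀ (by positivity) hV hcons
    x (η := ε / 2 / K) (by positivity)
  have hcpt : IsCompact ((fun s => U s x) '' Set.Icc 0 t₀) :=
    isCompact_Icc.image_of_continuousOn ((hU.2.2 x).mono Set.Icc_subset_Ici_self)
  have hproj := eventually_norm_apply_sub_le_of_isCompact (Q := fun m => J m ∘L P m)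
    (mul_nonneg hK.le hK.le) (fun m => (ContinuousLinearMap.opNorm_comp_le _ _).trans
      (mul_le_mul (hJnorm m) (hPnorm m) (norm_nonneg _) hK.le)) hJP hcpt (half_pos hε)
  obtain ⟨p₁, hp₁, p₂, hp₂, hp⟩ := eventually_prod_iff.1 hmain
  obtain ⟨N₁, hN₁⟩ := eventually_atTop.1 (hp₁.and hproj)
  obtain ⟨h₀, hh₀, hp₂⟩ := mem_nhdsGT_iff_exists_Ioo_subset.1 hp₂
  have hh₀ : 0 < h₀ := hh₀
  obtain ⟨N₂, hN₂⟩ := exists_nat_gt (t₀ / h₀)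
  refine ⟨max N₁ (N₂ + 1), fun m hm n hn t ht htt => ?_⟩
  obtain ⟨hm₁, hm₂⟩ := hN₁ m ((le_max_left _ _).trans hm)
  have hn₂ : N₂ + 1 ≤ n := (le_max_right _ _).trans hn
  have hnpos : (0 : ℝ) < n := by exact_mod_cast (show 0 < n by omega)
  have hnt : n * (t / n) = t := mul_div_cancel₀ t hnpos.ne'
  have hJPU := hm₂ _ ⟨t, ⟨ht, htt⟩, rfl⟩
  have hfull : ‖(V m (t / n) ^ n) (P m x) - P m (U t x)‖ ≤ ε / 2 / K := by
    rcases ht.eq_or_lt with rfl | ht'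
    · have : V m (0 / n) = 1 := by simp [hVdef, ratOp]
      rw [this, one_pow, hU.1]
      simp only [one_apply_eq_self, sub_self, norm_zero]
      positivity
    · have hlt : t / n < h₀ := by
        rw [div_lt_iff₀ hh₀] at hN₂
        rw [div_lt_iff₀ hnpos]
        have : (N₂ : ℝ) + 1 ≤ n := by exact_mod_cast hn₂
        nlinarith
      have h1 := hp hm₁ (hp₂ ⟨by positivity, hlt⟩) n (by simp only [hnt]; exact htt)
      simpa only [hnt] using h1
  have h1 : J m ((V m (t / n) ^ n) (P m x)) - U t x
      = J m ((V m (t / n) ^ n) (P m x) - P m (U t x)) + (J m (P m (U t x)) - U t x) := by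
    rw [map_sub]; abel
  have h2 := (J m).le_of_opNorm_le_of_le (hJnorm m) hfull
  rw [mul_div_cancel₀ _ hK.ne'] at h2
  rw [h1]
  refine (norm_add_le _ _).trans ((add_le_add h2 hJPU).trans (add_halves ε).le)
end
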